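/- (Theorem 1(iii)) Let α ∈ ℂ with 0 < Re α ≤ 1/2 and α ≠ 1/2, set λ = sin(πα)/π (so Re λ > 0 and λ ≠ 1/π), let g ∈ E, and let (φ₁, φ₂) be an admissible weight pair. Then f ∈ E satisfies the Stieltjes equation f(x) = g(x) + λ ∫₀^∞ f(y)/(x+y) dy for almost every x > 0 if and only if there exist constants A, B ∈ ℂ such that f(x) = g(x) − (tan(πα)/π)·x·∫₀^∞ (φ₁(y)·(y/x) + φ₂(y)·(x/y))·((y/x)^{α} − (y/x)^{1−α})/(x² − y²)·g(y) dy + A·x^{-α} + B·x^{α−1} for almost every x > 0, where the integral is absolutely convergent for every x > 0. -/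

import Mathlib

open MeasureTheory Set Asymptotics

noncomputable section

/-- `r₁(x;α)` from Dixon's resolvent kernels. -/
def r1 (α : ℂ) (x : ℝ) : ℂ :=
  if α = -(1/2 : ℂ) then
    -(2 / (Real.pi : ℂ)) * ((x : ℂ) ^ ((1 : ℂ)/2) * (Real.log x : ℂ)) / (1 - (x : ℂ) ^ 2)
  else
    (1 / Complex.cos ((Real.pi : ℂ) * α)) *
      (((x : ℂ) ^ (-α) - (x : ℂ) ^ (α + 1)) / (1 - (x : ℂ) ^ 2))

def r2 (α : ℂ) (x : ℝ) : ℂ := -(1 / (x : ℂ)) * r1 (-α) x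

def r3 (α : ℂ) (x : ℝ) : ℂ := (x : ℂ) ^ 2 * r2 α x

def R1 (α : ℂ) (x y : ℝ) : ℂ := (1 / (y : ℂ)) * r1 α (x / y)
def R2 (α : ℂ) (x y : ℝ) : ℂ := (1 / (y : ℂ)) * r2 α (x / y)
def R3 (α : ℂ) (x y : ℝ) : ℂ := (1 / (y : ℂ)) * r3 α (x / y)

/-- membership in `E`: integrable on `(0,∞)` with weight `1/(1+x)`. -/
def MemE (f : ℝ → ℂ) : Prop :=
  IntegrableOn (fun x : ℝ => f x / (1 + (x : ℂ))) (Ioi 0)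

/-- membership in `E_k`: integrable on `(0,∞)` with weight `x^{k-1}`. -/
def MemEk (k : ℝ) (f : ℝ → ℂ) : Prop :=
  IntegrableOn (fun x : ℝ => (x ^ (k - 1) : ℝ) • f x) (Ioi 0)

/-- membership in `B_{ε,η}`. -/
def MemB (ε η : ℝ) (f : ℝ → ℂ) : Prop :=
  ContinuousOn f (Ioi 0) ∧
  ∃ M : ℝ, (∀ x : ℝ, 1 < x → x ^ ε * ‖f x‖ ≤ M) ∧ (∀ x : ℝ, 0 < x → x < 1 → x ^ η * ‖f x‖ ≤ M)

/-- the norm of `B_{ε,η}`. -/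
def Bnorm (ε η : ℝ) (f : ℝ → ℂ) : ℝ :=
  sSup ((fun x : ℝ => x ^ ε * ‖f x‖) '' Ioi 1) + sSup ((fun x : ℝ => x ^ η * ‖f x‖) '' Ioo 0 1)

/-- admissible weight pair `(φ₁,φ₂)`. -/
def AdmissiblePair (φ₁ φ₂ : ℝ → ℝ) : Prop :=
  ContinuousOn φ₁ (Ioi 0) ∧ ContinuousOn φ₂ (Ioi 0) ∧
  (∀ y : ℝ, 0 < y → (φ₁ y ∈ Ioo (0:ℝ) 1 ∧ φ₂ y ∈ Ioo (0:ℝ) 1 ∧ φ₁ y + φ₂ y = 1)) ∧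
  φ₁ =O[Filter.atTop] (fun y : ℝ => 1 / y) ∧
  (fun y : ℝ => φ₁ y - 1) =O[nhdsWithin 0 (Ioi 0)] (fun y : ℝ => y)

/-- the combined kernel `R₂₃`. -/
def R23 (φ₁ φ₂ : ℝ → ℝ) (α : ℂ) (x y : ℝ) : ℂ :=
  (φ₁ y : ℂ) * R2 α x y + (φ₂ y : ℂ) * R3 α x y


theorem image_div_one_sub_Ioo : (fun t : ℝ => t / (1 - t)) '' Ioo 0 1 = Ioi 0 := by
  ext s
  constructor
  · rintro ⟨t, ⟨h0, h1⟩, rfl⟩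
    exact div_pos h0 (by linarith)
  · intro hs
    have hs : 0 < s := hs
    refine ⟨s / (1 + s), ⟨by positivity, by rw [div_lt_one (by positivity)]; linarith⟩, ?_⟩
    simp only
    field_simp
    ring

theorem hasDerivAt_div_one_sub {t : ℝ} (ht : t ≠ 1) :
    HasDerivAt (fun t : ℝ => t / (1 - t)) (1 / (1 - t) ^ 2) t := by
  have h1 : 1 - t ≠ 0 := sub_ne_zero.2 ht.symm
  convert! (hasDerivAt_id t).div ((hasDerivAt_const t (1 : ℝ)).sub (hasDerivAt_id t)) h1 using 1
  simp

theorem injOn_div_one_sub : InjOn (fun t : ℝ => t / (1 - t)) (Ioo 0 1) := by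
  intro s hs t ht h
  have h1 : 1 - s ≠ 0 := by linarith [hs.2]
  have h2 : 1 - t ≠ 0 := by linarith [ht.2]
  simp only at h
  rw [div_eq_div_iff h1 h2] at h
  linarith

theorem one_div_mul_stieltjes_integrand {β : ℂ} {t : ℝ} (ht : t ∈ Ioo (0 : ℝ) 1) :
    |1 / (1 - t) ^ 2| • (((t / (1 - t) : ℝ) : ℂ) ^ (-β) / (1 + ((t / (1 - t) : ℝ) : ℂ))) =
      (t : ℂ) ^ ((1 - β) - 1) * (1 - (t : ℂ)) ^ (β - 1) := by
  obtain ⟨h0, h1⟩ := ht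
  have h1' : 0 < 1 - t := by linarith
  have hc : (1 : ℂ) - t ≠ 0 := by exact_mod_cast h1'.ne'
  have e1 : ((t / (1 - t) : ℝ) : ℂ) ^ (-β) = (t : ℂ) ^ (-β) * (1 - (t : ℂ)) ^ β := by
    rw [div_eq_mul_inv, Complex.ofReal_mul,
      Complex.mul_cpow_ofReal_nonneg h0.le (inv_nonneg.2 h1'.le), Complex.ofReal_inv,
      Complex.cpow_neg _ β, Complex.inv_cpow, Complex.cpow_neg, inv_inv]
    · push_cast; rfl
    · rw [Complex.arg_ofReal_of_nonneg h1'.le]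
      exact Real.pi_pos.ne
  have e2 : (1 - (t : ℂ)) ^ (β - 1) = (1 - (t : ℂ)) ^ β / (1 - t) := by
    rw [Complex.cpow_sub _ _ hc, Complex.cpow_one]
  have e3 : (1 : ℂ) - β - 1 = -β := by ring
  rw [e1, e2, e3, abs_of_pos (by positivity), Complex.real_smul]
  push_cast
  field_simp
  ring

theorem integrableOn_cpow_div_one_add {β : ℂ} (h0 : 0 < β.re) (h1 : β.re < 1) :
    IntegrableOn (fun s : ℝ => (s : ℂ) ^ (-β) / (1 + (s : ℂ))) (Ioi 0) := by
  rw [← image_div_one_sub_Ioo, integrableOn_image_iff_integrableOn_abs_deriv_smul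
    measurableSet_Ioo (fun t ht => (hasDerivAt_div_one_sub ht.2.ne).hasDerivWithinAt)
    injOn_div_one_sub]
  rw [integrableOn_congr_fun (fun t ht => one_div_mul_stieltjes_integrand ht) measurableSet_Ioo,
    ← intervalIntegrable_iff_integrableOn_Ioo_of_le zero_le_one]
  exact Complex.betaIntegral_convergent (by simpa using h1) h0

theorem integral_cpow_div_one_add {β : ℂ} (h0 : 0 < β.re) (h1 : β.re < 1) :
    ∫ s in Ioi (0 : ℝ), (s : ℂ) ^ (-β) / (1 + (s : ℂ)) =
      (Real.pi : ℂ) / Complex.sin (Real.pi * β) := by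
  rw [← image_div_one_sub_Ioo, integral_image_eq_integral_abs_deriv_smul
    measurableSet_Ioo (fun t ht => (hasDerivAt_div_one_sub ht.2.ne).hasDerivWithinAt)
    injOn_div_one_sub]
  rw [setIntegral_congr_fun measurableSet_Ioo (fun t ht => one_div_mul_stieltjes_integrand ht),
    ← integral_Ioc_eq_integral_Ioo, ← intervalIntegral.integral_of_le zero_le_one]
  have := Complex.Gamma_mul_Gamma_eq_betaIntegral (s := 1 - β) (t := β) (by simpa using h1) h0
  rw [sub_add_cancel, Complex.Gamma_one, one_mul, mul_comm, Complex.Gamma_mul_Gamma_one_sub] at this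
  rw [this]
  rfl

theorem cpow_mul_pos {x y : ℝ} (hx : 0 < x) (hy : 0 < y) (γ : ℂ) :
    ((x * y : ℝ) : ℂ) ^ γ = (x : ℂ) ^ γ * (y : ℂ) ^ γ := by
  rw [Complex.ofReal_mul, Complex.mul_cpow_ofReal_nonneg hx.le hy.le]

theorem cpow_inv_pos {x : ℝ} (hx : 0 < x) (γ : ℂ) :
    ((x⁻¹ : ℝ) : ℂ) ^ γ = (x : ℂ) ^ (-γ) := by
  rw [Complex.ofReal_inv, Complex.inv_cpow, Complex.cpow_neg]
  rw [Complex.arg_ofReal_of_nonneg hx.le]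
  exact Real.pi_pos.ne

theorem stieltjes_cpow_scale {β : ℂ} {x s : ℝ} (hx : 0 < x) (hs : 0 < s) :
    ((x * s : ℝ) : ℂ) ^ (-β) / ((x : ℂ) + ((x * s : ℝ) : ℂ)) =
      (x : ℂ) ^ (-β) / x * ((s : ℂ) ^ (-β) / (1 + (s : ℂ))) := by
  have hxc : (x : ℂ) ≠ 0 := by exact_mod_cast hx.ne'
  have hsc : (1 : ℂ) + s ≠ 0 := by exact_mod_cast (by positivity : (1 : ℝ) + s ≠ 0)
  rw [cpow_mul_pos hx hs, show (x : ℂ) + ((x * s : ℝ) : ℂ) = x * (1 + s) by push_cast; ring]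
  field_simp

theorem integrableOn_cpow_div_add {β : ℂ} (h0 : 0 < β.re) (h1 : β.re < 1) {x : ℝ} (hx : 0 < x) :
    IntegrableOn (fun s : ℝ => (s : ℂ) ^ (-β) / ((x : ℂ) + (s : ℂ))) (Ioi 0) := by
  have := integrableOn_Ioi_comp_mul_left_iff
    (fun s : ℝ => (s : ℂ) ^ (-β) / ((x : ℂ) + (s : ℂ))) 0 hx
  rw [mul_zero] at this
  rw [← this, integrableOn_congr_fun (fun s hs => stieltjes_cpow_scale hx (mem_Ioi.1 hs))
    measurableSet_Ioi]
  exact (integrableOn_cpow_div_one_add h0 h1).const_mul _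

theorem integral_cpow_div_add {β : ℂ} (h0 : 0 < β.re) (h1 : β.re < 1) {x : ℝ} (hx : 0 < x) :
    ∫ s in Ioi (0 : ℝ), (s : ℂ) ^ (-β) / ((x : ℂ) + (s : ℂ)) =
      (Real.pi : ℂ) / Complex.sin (Real.pi * β) * (x : ℂ) ^ (-β) := by
  have hxc : (x : ℂ) ≠ 0 := by exact_mod_cast hx.ne'
  have := integral_comp_mul_left_Ioi
    (fun s : ℝ => (s : ℂ) ^ (-β) / ((x : ℂ) + (s : ℂ))) 0 hx
  rw [mul_zero, setIntegral_congr_fun measurableSet_Ioi (fun s hs => stieltjes_cpow_scale hx hs),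
    integral_const_mul, integral_cpow_div_one_add h0 h1, eq_inv_smul_iff₀ hx.ne',
    Complex.real_smul] at this
  rw [← this]
  field_simp

theorem integrableOn_rpow_div_one_add {b : ℝ} (h0 : 0 < b) (h1 : b < 1) :
    IntegrableOn (fun s : ℝ => s ^ (-b) / (1 + s)) (Ioi 0) := by
  have := (integrableOn_cpow_div_one_add (β := b) (by simpa) (by simpa)).norm
  refine (integrableOn_congr_fun (fun s hs => ?_) measurableSet_Ioi).1 this
  have hs : 0 < s := hs
  simp only [norm_div]
  rw [Complex.norm_cpow_eq_rpow_re_of_pos hs,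
    show (1 : ℂ) + s = ((1 + s : ℝ) : ℂ) by push_cast; rfl, Complex.norm_real, Real.norm_eq_abs,
    abs_of_pos (by positivity)]
  simp

/-- The numerator of the Dixon resolvent kernels. -/
def powDiff (α : ℂ) (s : ℝ) : ℂ := (s : ℂ) ^ (-α) - (s : ℂ) ^ (α - 1)

/-- The natural majorant of `powDiff α`, with `a = re α`. -/
def powSum (a s : ℝ) : ℝ := s ^ (-a) + s ^ (a - 1)

theorem powSum_nonneg (a : ℝ) {s : ℝ} (hs : 0 < s) : 0 ≤ powSum a s := by
  unfold powSum; positivity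

theorem norm_powDiff_le_powSum (α : ℂ) {s : ℝ} (hs : 0 < s) :
    ‖powDiff α s‖ ≤ powSum α.re s := by
  unfold powDiff powSum
  refine (norm_sub_le _ _).trans_eq ?_
  rw [Complex.norm_cpow_eq_rpow_re_of_pos hs, Complex.norm_cpow_eq_rpow_re_of_pos hs]
  simp

theorem integrableOn_powSum_div {a : ℝ} (h0 : 0 < a) (h1 : a < 1) :
    IntegrableOn (fun s : ℝ => powSum a s / (1 + s)) (Ioi 0) := by
  have := (integrableOn_rpow_div_one_add h0 h1).add
    (integrableOn_rpow_div_one_add (b := 1 - a) (by linarith) (by linarith))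
  refine this.congr (ae_of_all _ fun s => ?_)
  simp [powSum, add_div]

theorem hasDerivAt_powDiff (α : ℂ) {s : ℝ} (hs : 0 < s) :
    HasDerivAt (powDiff α)
      (-α * (s : ℂ) ^ (-α - 1) - (α - 1) * (s : ℂ) ^ (α - 1 - 1)) s := by
  have hc : (s : ℂ) ∈ Complex.slitPlane := Complex.ofReal_mem_slitPlane.2 hs
  have key : ∀ γ : ℂ, HasDerivAt (fun t : ℝ => (t : ℂ) ^ γ) (γ * (s : ℂ) ^ (γ - 1)) s := by
    intro γ
    have := ((hasDerivAt_id (s : ℂ)).cpow_const (c := γ) hc).comp_ofReal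
    simpa using this
  exact (key _).sub (key _)

theorem continuousOn_ofReal_cpow (γ : ℂ) :
    ContinuousOn (fun t : ℝ => (t : ℂ) ^ γ) (Ioi 0) := fun _ ht =>
  (Complex.continuousAt_ofReal_cpow_const _ _ (Or.inr (ne_of_gt ht))).continuousWithinAt

theorem continuousOn_powDiff (α : ℂ) : ContinuousOn (powDiff α) (Ioi 0) :=
  (continuousOn_ofReal_cpow _).sub (continuousOn_ofReal_cpow _)

theorem powDiff_one (α : ℂ) : powDiff α 1 = 0 := by simp [powDiff]

theorem exists_norm_powDiff_le_near_one (α : ℂ) :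
    ∃ C : ℝ, 0 ≤ C ∧ ∀ s ∈ Icc (1 / 2 : ℝ) 2, ‖powDiff α s‖ ≤ C * |s - 1| := by
  have hsub : Icc (1 / 2 : ℝ) 2 ⊆ Ioi 0 := fun s hs => lt_of_lt_of_le (by norm_num) hs.1
  obtain ⟨C, hC⟩ := (isCompact_Icc (a := (1 / 2 : ℝ)) (b := 2)).exists_bound_of_continuousOn
    (f := fun s : ℝ => -α * (s : ℂ) ^ (-α - 1) - (α - 1) * (s : ℂ) ^ (α - 1 - 1))
    (((continuousOn_const.mul (continuousOn_ofReal_cpow _)).sub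
      (continuousOn_const.mul (continuousOn_ofReal_cpow _))).mono hsub)
  refine ⟨C, (norm_nonneg _).trans (hC 1 (by norm_num)), fun s hs => ?_⟩
  have := (convex_Icc (1 / 2 : ℝ) 2).norm_image_sub_le_of_norm_hasDerivWithin_le
    (fun _ ht => (hasDerivAt_powDiff α (hsub ht)).hasDerivWithinAt) hC
    (show (1 : ℝ) ∈ Icc (1 / 2 : ℝ) 2 by norm_num) hs
  simpa [powDiff_one] using this

theorem exists_norm_powDiff_le (α : ℂ) :
    ∃ C : ℝ, 0 < C ∧ ∀ s : ℝ, 0 < s →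
      ‖powDiff α s‖ ≤ C * (|s - 1| * (powSum α.re s / (1 + s))) := by
  obtain ⟨C₁, hC₁, h₁⟩ := exists_norm_powDiff_le_near_one α
  have hsub : Icc (1 / 2 : ℝ) 2 ⊆ Ioi 0 := fun s hs => lt_of_lt_of_le (by norm_num) hs.1
  obtain ⟨C₂, hC₂⟩ := (isCompact_Icc (a := (1 / 2 : ℝ)) (b := 2)).exists_bound_of_continuousOn
    (f := fun s : ℝ => (powSum α.re s / (1 + s))⁻¹) (by
      intro s hs
      have hs0 : 0 < s := hsub hs
      refine ContinuousAt.continuousWithinAt ?_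
      unfold powSum
      refine ContinuousAt.inv₀ (((Real.continuousAt_rpow_const _ _ (Or.inl hs0.ne')).add
        (Real.continuousAt_rpow_const _ _ (Or.inl hs0.ne'))).div (by fun_prop) (by positivity)) ?_
      positivity)
  have hC₂0 : 0 ≤ C₂ := (norm_nonneg _).trans (hC₂ 1 (by norm_num))
  refine ⟨C₁ * C₂ + 3, by positivity, fun s hs => ?_⟩
  have hW : 0 < powSum α.re s / (1 + s) := by unfold powSum; positivity
  set W := powSum α.re s / (1 + s) with hWdef
  have habs : 0 ≤ |s - 1| := abs_nonneg _
  by_cases hmem : s ∈ Icc (1 / 2 : ℝ) 2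
  · have h2 : 1 ≤ C₂ * W := by
      have := hC₂ s hmem
      rw [Real.norm_eq_abs, abs_of_pos (by positivity)] at this
      calc (1 : ℝ) = W⁻¹ * W := by field_simp
        _ ≤ _ := by gcongr
    calc ‖powDiff α s‖ ≤ C₁ * |s - 1| * 1 := by simpa using h₁ s hmem
      _ ≤ C₁ * |s - 1| * (C₂ * W) := by gcongr
      _ ≤ _ := by nlinarith [mul_nonneg habs hW.le]
  · have h3 : 1 + s ≤ 3 * |s - 1| := by
      rw [mem_Icc, not_and_or] at hmem
      rcases hmem with h | h
      · rw [abs_of_nonpos] <;> linarith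
      · rw [abs_of_nonneg] <;> linarith
    have h4 : powSum α.re s = (1 + s) * W := by rw [hWdef]; field_simp
    calc ‖powDiff α s‖ ≤ (1 + s) * W := h4 ▸ norm_powDiff_le_powSum α hs
      _ ≤ 3 * |s - 1| * W := by gcongr
      _ ≤ _ := by nlinarith [mul_nonneg habs hW.le, mul_nonneg hC₁ hC₂0,
                  mul_nonneg (mul_nonneg hC₁ hC₂0) (mul_nonneg habs hW.le)]

theorem integrableOn_powDiff_div_sub_one {α : ℂ} (h0 : 0 < α.re) (h1 : α.re < 1) :
    IntegrableOn (fun s : ℝ => powDiff α s / ((s : ℂ) - 1)) (Ioi 0) := by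
  obtain ⟨C, hC, h⟩ := exists_norm_powDiff_le α
  refine ((integrableOn_powSum_div h0 h1).const_mul C).mono' ?_ ?_
  · have h2 : AEStronglyMeasurable (fun s : ℝ => ((s : ℂ) - 1)⁻¹)
        (volume.restrict (Ioi (0 : ℝ))) := by
      apply Measurable.aestronglyMeasurable
      fun_prop
    exact ((continuousOn_powDiff α).aestronglyMeasurable measurableSet_Ioi).mul h2
  · filter_upwards [ae_restrict_mem measurableSet_Ioi] with s hs
    have hs : 0 < s := hs
    have hW : 0 ≤ powSum α.re s / (1 + s) := div_nonneg (powSum_nonneg _ hs) (by positivity)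
    rw [norm_div, show (s : ℂ) - 1 = ((s - 1 : ℝ) : ℂ) by push_cast; rfl, Complex.norm_real,
      Real.norm_eq_abs]
    refine div_le_of_le_mul₀ (abs_nonneg _) (by positivity) ((h s hs).trans_eq (by ring))

theorem powDiff_inv (α : ℂ) {s : ℝ} (hs : 0 < s) : powDiff α s⁻¹ = -(s * powDiff α s) := by
  have hc : (s : ℂ) ≠ 0 := by exact_mod_cast hs.ne'
  have h1 : (s : ℂ) ^ (α - 1) = (s : ℂ) ^ α / s := by
    rw [Complex.cpow_sub _ _ hc, Complex.cpow_one]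
  have h2 : (s : ℂ) ^ (1 - α) = (s : ℂ) ^ (-α) * s := by
    rw [sub_eq_neg_add, Complex.cpow_add _ _ hc, Complex.cpow_one]
  unfold powDiff
  rw [cpow_inv_pos hs, cpow_inv_pos hs, neg_neg, neg_sub, h1, h2]
  field_simp
  ring

theorem integral_pow_mul_powDiff {α : ℂ} (h0 : 0 < α.re) (h1 : α.re < 1) (n : ℕ) :
    IntegrableOn (fun s : ℝ => (s : ℂ) ^ n * powDiff α s) (Ioo 0 1) ∧
    ∫ s in Ioo (0 : ℝ) 1, (s : ℂ) ^ n * powDiff α s = 1 / (n + 1 - α) - 1 / (n + α) := by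
  have hn : (0 : ℝ) ≤ n := n.cast_nonneg
  have key : ∀ γ : ℂ, -1 < γ.re →
      IntegrableOn (fun s : ℝ => (s : ℂ) ^ γ) (Ioo 0 1) ∧
        ∫ s in Ioo (0 : ℝ) 1, (s : ℂ) ^ γ = 1 / (γ + 1) := by
    intro γ hγ
    have hne : γ + 1 ≠ 0 := by
      intro h
      have := congrArg Complex.re h
      simp at this
      linarith
    rw [← intervalIntegrable_iff_integrableOn_Ioo_of_le zero_le_one,
      ← integral_Ioc_eq_integral_Ioo, ← intervalIntegral.integral_of_le zero_le_one]
    refine ⟨intervalIntegral.intervalIntegrable_cpow' hγ, ?_⟩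
    rw [integral_cpow (Or.inl hγ)]
    simp [Complex.zero_cpow hne]
  obtain ⟨i1, e1⟩ := key (n - α) (by simp; linarith)
  obtain ⟨i2, e2⟩ := key (n + α - 1) (by simp; linarith)
  have hfun : EqOn (fun s : ℝ => (s : ℂ) ^ ((n : ℂ) - α) - (s : ℂ) ^ ((n : ℂ) + α - 1))
      (fun s : ℝ => (s : ℂ) ^ n * powDiff α s) (Ioo 0 1) := by
    intro s hs
    have hc : (s : ℂ) ≠ 0 := by exact_mod_cast hs.1.ne'
    simp only [powDiff]
    rw [sub_eq_add_neg (n : ℂ), add_sub_assoc, Complex.cpow_add _ _ hc, Complex.cpow_add _ _ hc,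
      Complex.cpow_natCast]
    ring
  refine ⟨(integrableOn_congr_fun hfun measurableSet_Ioo).1 (i1.sub i2), ?_⟩
  rw [← setIntegral_congr_fun measurableSet_Ioo hfun, integral_sub i1 i2, e1, e2]
  congr 2 <;> ring

theorem mem_integerComplement_of_re {α : ℂ} (h0 : 0 < α.re) (h1 : α.re < 1) :
    α ∈ Complex.integerComplement := by
  rw [Complex.mem_integerComplement_iff]
  rintro ⟨n, rfl⟩
  simp only [Complex.intCast_re] at h0 h1
  have h0' : (0 : ℤ) < n := by exact_mod_cast h0
  have h1' : n < (1 : ℤ) := by exact_mod_cast h1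
  omega

theorem tendsto_sum_cot {α : ℂ} (h0 : 0 < α.re) (h1 : α.re < 1) :
    Filter.Tendsto (fun N : ℕ => ∑ n ∈ Finset.range N, (1 / ((n : ℂ) + 1 - α) - 1 / (n + α)))
      Filter.atTop (nhds (-(Real.pi * Complex.cot (Real.pi * α)))) := by
  have hα := mem_integerComplement_of_re h0 h1
  have hs := (summable_cotTerm hα).hasSum.tendsto_sum_nat
  have hlim : ∑' n : ℕ, cotTerm α n = Real.pi * Complex.cot (Real.pi * α) - 1 / α :=
    (cot_series_rep' hα).symm
  rw [hlim] at hs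
  have hz : Filter.Tendsto (fun N : ℕ => 1 / ((N : ℂ) + α)) Filter.atTop (nhds 0) := by
    simp only [one_div]
    exact Filter.tendsto_inv₀_cobounded.comp
      ((tendsto_add_const_cobounded α).comp tendsto_natCast_atTop_cobounded)
  have := (hs.neg.sub_const (1 / α)).add hz
  refine (this.congr fun N => ?_).trans (by simp)
  induction N with
  | zero => simp
  | succ N ih =>
    rw [Finset.sum_range_succ, Finset.sum_range_succ, ← ih, cotTerm]
    rw [show α - ((N : ℂ) + 1) = -((N : ℂ) + 1 - α) by ring, one_div_neg_eq_neg_one_div]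
    push_cast
    rw [show α + ((N : ℂ) + 1) = (N : ℂ) + 1 + α by ring]
    ring

theorem integral_Ioo_powDiff_div_sub_one {α : ℂ} (h0 : 0 < α.re) (h1 : α.re < 1) :
    ∫ s in Ioo (0 : ℝ) 1, powDiff α s / ((s : ℂ) - 1) =
      Real.pi * Complex.cot (Real.pi * α) := by
  have hint := (integrableOn_powDiff_div_sub_one h0 h1).mono_set
    (Ioo_subset_Ioi_self : Ioo (0 : ℝ) 1 ⊆ Ioi 0)
  have hne : ∀ s ∈ Ioo (0 : ℝ) 1, (s : ℂ) - 1 ≠ 0 := by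
    intro s hs
    rw [sub_ne_zero]
    exact_mod_cast hs.2.ne
  have hpart : ∀ N : ℕ, ∫ s in Ioo (0 : ℝ) 1,
      (-(powDiff α s / ((s : ℂ) - 1)) * (1 - (s : ℂ) ^ N)) =
      ∑ n ∈ Finset.range N, (1 / ((n : ℂ) + 1 - α) - 1 / (n + α)) := by
    intro N
    simp_rw [← fun n => (integral_pow_mul_powDiff h0 h1 n).2]
    rw [← integral_finsetSum _ fun n _ => (integral_pow_mul_powDiff h0 h1 n).1]
    refine setIntegral_congr_fun measurableSet_Ioo fun s hs => ?_
    rw [← Finset.sum_mul, geom_sum_eq (fun h => hne s hs (by rw [h, sub_self]))]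
    field_simp [hne s hs]
    ring
  have hlim : Filter.Tendsto (fun N : ℕ => ∫ s in Ioo (0 : ℝ) 1,
      (-(powDiff α s / ((s : ℂ) - 1)) * (1 - (s : ℂ) ^ N))) Filter.atTop
      (nhds (∫ s in Ioo (0 : ℝ) 1, -(powDiff α s / ((s : ℂ) - 1)))) := by
    refine tendsto_integral_of_dominated_convergence
      (fun s => ‖powDiff α s / ((s : ℂ) - 1)‖ * 2) (fun N => ?_) (hint.norm.mul_const 2)
      (fun N => ?_) ?_
    · refine hint.aestronglyMeasurable.neg.mul (Continuous.aestronglyMeasurable ?_)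
      fun_prop
    · filter_upwards [ae_restrict_mem measurableSet_Ioo] with s hs
      rw [norm_mul, norm_neg]
      gcongr
      refine (norm_sub_le _ _).trans ?_
      rw [norm_one, norm_pow, Complex.norm_real, Real.norm_eq_abs, abs_of_pos hs.1]
      linarith [pow_le_one₀ (n := N) hs.1.le hs.2.le]
    · filter_upwards [ae_restrict_mem measurableSet_Ioo] with s hs
      have hp : Filter.Tendsto (fun N : ℕ => (s : ℂ) ^ N) Filter.atTop (nhds 0) := by
        apply tendsto_pow_atTop_nhds_zero_of_norm_lt_one
        rw [Complex.norm_real, Real.norm_eq_abs, abs_of_pos hs.1]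
        exact hs.2
      simpa using (hp.const_sub 1).const_mul (-(powDiff α s / ((s : ℂ) - 1)))
  simp_rw [hpart] at hlim
  have := tendsto_nhds_unique hlim (tendsto_sum_cot h0 h1)
  rw [integral_neg, neg_inj] at this
  exact this

theorem integral_powDiff_div_sub_one {α : ℂ} (h0 : 0 < α.re) (h1 : α.re < 1) :
    ∫ s in Ioi (0 : ℝ), powDiff α s / ((s : ℂ) - 1) =
      2 * (Real.pi * Complex.cot (Real.pi * α)) := by
  have hint := integrableOn_powDiff_div_sub_one h0 h1
  have himg : (fun s : ℝ => s⁻¹) '' Ioo 0 1 = Ioi 1 := by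
    rw [image_inv_eq_inv]
    simpa using inv_Ioo_0_left (zero_lt_one (α := ℝ))
  have hinv : ∫ s in Ioi (1 : ℝ), powDiff α s / ((s : ℂ) - 1) =
      ∫ s in Ioo (0 : ℝ) 1, powDiff α s / ((s : ℂ) - 1) := by
    rw [← himg, integral_image_eq_integral_abs_deriv_smul measurableSet_Ioo
      (fun t ht => (hasDerivAt_inv ht.1.ne').hasDerivWithinAt) inv_injective.injOn]
    refine setIntegral_congr_fun measurableSet_Ioo fun s hs => ?_
    have hs0 : 0 < s := hs.1
    have hc : (s : ℂ) ≠ 0 := by exact_mod_cast hs0.ne'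
    have hc1 : (s : ℂ) - 1 ≠ 0 := sub_ne_zero.2 (by exact_mod_cast hs.2.ne)
    have hc2 : (1 : ℂ) - s ≠ 0 := by rw [← neg_sub]; exact neg_ne_zero.2 hc1
    rw [powDiff_inv α hs0, abs_neg, abs_of_pos (by positivity), Complex.real_smul]
    push_cast
    field_simp
    rw [← neg_sub (s : ℂ) 1]
    field_simp
  rw [← Ioc_union_Ioi_eq_Ioi (zero_le_one (α := ℝ)),
    setIntegral_union Ioc_disjoint_Ioi_same measurableSet_Ioi
      (hint.mono_set Ioc_subset_Ioi_self) (hint.mono_set (Ioi_subset_Ioi zero_le_one)),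
    integral_Ioc_eq_integral_Ioo, hinv, integral_Ioo_powDiff_div_sub_one h0 h1]
  ring

theorem integral_powDiff_div_add {α : ℂ} (h0 : 0 < α.re) (h1 : α.re < 1) {x : ℝ} (hx : 0 < x) :
    IntegrableOn (fun s : ℝ => powDiff α s / ((x : ℂ) + s)) (Ioi 0) ∧
    ∫ s in Ioi (0 : ℝ), powDiff α s / ((x : ℂ) + s) =
      (Real.pi : ℂ) / Complex.sin (Real.pi * α) * powDiff α x := by
  have h0' : 0 < (1 - α).re := by simpa using h1
  have h1' : (1 - α).re < 1 := by simpa using h0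
  have i1 := integrableOn_cpow_div_add h0 h1 hx
  have i2 := integrableOn_cpow_div_add h0' h1' hx
  have e1 := integral_cpow_div_add h0 h1 hx
  have e2 := integral_cpow_div_add h0' h1' hx
  have hsin : Complex.sin (Real.pi * (1 - α)) = Complex.sin (Real.pi * α) := by
    rw [mul_sub, mul_one, Complex.sin_pi_sub]
  rw [hsin] at e2
  rw [neg_sub] at e2
  simp only [neg_sub] at i2 e2
  have hfun : (fun s : ℝ => powDiff α s / ((x : ℂ) + s)) = fun s : ℝ =>
      (s : ℂ) ^ (-α) / ((x : ℂ) + s) - (s : ℂ) ^ (α - 1) / ((x : ℂ) + s) := by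
    funext s
    rw [powDiff, sub_div]
  rw [hfun]
  refine ⟨i1.sub i2, ?_⟩
  rw [integral_sub i1 i2, e1, e2, powDiff]
  ring

theorem integral_resolvent_profile_div_add {α : ℂ} (h0 : 0 < α.re) (h1 : α.re < 1) {x : ℝ}
    (hx : 0 < x) (hx1 : x ≠ 1) :
    IntegrableOn (fun s : ℝ => powDiff α s / ((s : ℂ) ^ 2 - 1) / ((x : ℂ) + s)) (Ioi 0) ∧
    ∫ s in Ioi (0 : ℝ), powDiff α s / ((s : ℂ) ^ 2 - 1) / ((x : ℂ) + s) =
      (Real.pi : ℂ) / Complex.sin (Real.pi * α) * (powDiff α x / ((x : ℂ) ^ 2 - 1)) +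
        Real.pi * Complex.cot (Real.pi * α) / (x + 1) := by
  obtain ⟨ix, ex⟩ := integral_powDiff_div_add h0 h1 hx
  obtain ⟨i1, e1⟩ := integral_powDiff_div_add h0 h1 one_pos
  have i2 := integrableOn_powDiff_div_sub_one h0 h1
  have e2 := integral_powDiff_div_sub_one h0 h1
  rw [powDiff_one, mul_zero] at e1
  have c1 : (x : ℂ) - 1 ≠ 0 := sub_ne_zero.2 (by exact_mod_cast hx1)
  have c2 : (x : ℂ) + 1 ≠ 0 := by exact_mod_cast (by positivity : x + 1 ≠ 0)
  have c3 : (x : ℂ) ^ 2 - 1 ≠ 0 := by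
    rw [show (x : ℂ) ^ 2 - 1 = (x - 1) * (x + 1) by ring]
    exact mul_ne_zero c1 c2
  have hfun : EqOn (fun s : ℝ => 1 / ((x : ℂ) ^ 2 - 1) * (powDiff α s / ((x : ℂ) + s)) +
      1 / (2 * ((x : ℂ) + 1)) * (powDiff α s / ((s : ℂ) - 1)) -
      1 / (2 * ((x : ℂ) - 1)) * (powDiff α s / (((1 : ℝ) : ℂ) + s)))
      (fun s : ℝ => powDiff α s / ((s : ℂ) ^ 2 - 1) / ((x : ℂ) + s)) (Ioi 0) := by
    intro s hs
    have hs : 0 < s := hs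
    rcases eq_or_ne s 1 with rfl | hs1
    · simp [powDiff_one]
    have d1 : (s : ℂ) - 1 ≠ 0 := sub_ne_zero.2 (by exact_mod_cast hs1)
    have d2 : (1 : ℂ) + s ≠ 0 := by exact_mod_cast (by positivity : 1 + s ≠ 0)
    have d3 : (x : ℂ) + s ≠ 0 := by exact_mod_cast (by positivity : x + s ≠ 0)
    simp only [Complex.ofReal_one]
    rw [show (x : ℂ) ^ 2 - 1 = (x - 1) * (x + 1) by ring,
      show (s : ℂ) ^ 2 - 1 = (s - 1) * (1 + s) by ring]
    field_simp
    ring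
  have j := ((ix.const_mul (1 / ((x : ℂ) ^ 2 - 1))).fun_add
    (i2.const_mul (1 / (2 * ((x : ℂ) + 1)))))
  refine ⟨(integrableOn_congr_fun hfun measurableSet_Ioi).1
    (j.sub (i1.const_mul (1 / (2 * ((x : ℂ) - 1))))), ?_⟩
  rw [← setIntegral_congr_fun measurableSet_Ioi hfun, integral_sub j (i1.const_mul _),
    integral_add (ix.const_mul _) (i2.const_mul _), integral_const_mul, integral_const_mul,
    integral_const_mul, ex, e1, e2]
  field_simp
  ring

/-- The resolvent kernel of the Stieltjes transform (up to the factor `tan (π α) / π`);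
`θ = 0` and `θ = 1` are the two extreme choices, differing by solutions of the homogeneous
equation. -/
def dixonKernel (α : ℂ) (θ x y : ℝ) : ℂ :=
  (y : ℂ)⁻¹ * (powDiff α (x / y) / (((x / y : ℝ) : ℂ) ^ 2 - 1) + θ * powDiff α (x / y))

theorem integral_dixonKernel_div_add {α : ℂ} (h0 : 0 < α.re) (h1 : α.re < 1) (θ : ℝ) {x y : ℝ}
    (hx : 0 < x) (hy : 0 < y) (hxy : x ≠ y) :
    IntegrableOn (fun z : ℝ => dixonKernel α θ z y / ((x : ℂ) + z)) (Ioi 0) ∧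
    ∫ z in Ioi (0 : ℝ), dixonKernel α θ z y / ((x : ℂ) + z) =
      (Real.pi : ℂ) / Complex.sin (Real.pi * α) * dixonKernel α θ x y +
        Real.pi * Complex.cot (Real.pi * α) / (x + y) := by
  have hxy0 : 0 < x / y := by positivity
  have hxy1 : x / y ≠ 1 := by rwa [ne_eq, div_eq_one_iff_eq hy.ne']
  have hyc : (y : ℂ) ≠ 0 := by exact_mod_cast hy.ne'
  have hxyc : (x : ℂ) + y ≠ 0 := by exact_mod_cast (by positivity : x + y ≠ 0)
  obtain ⟨ih, eh⟩ := integral_powDiff_div_add h0 h1 hxy0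
  obtain ⟨ip, ep⟩ := integral_resolvent_profile_div_add h0 h1 hxy0 hxy1
  have hfun : EqOn (fun s : ℝ => dixonKernel α θ (y * s) y / ((x : ℂ) + ((y * s : ℝ) : ℂ)))
      (fun s : ℝ => (y : ℂ)⁻¹ * (y : ℂ)⁻¹ *
        (powDiff α s / ((s : ℂ) ^ 2 - 1) / (((x / y : ℝ) : ℂ) + s) +
          θ * (powDiff α s / (((x / y : ℝ) : ℂ) + s)))) (Ioi 0) := by
    intro s hs
    have hs : 0 < s := hs
    have d : (x : ℂ) + y * s ≠ 0 := by exact_mod_cast (by positivity : x + y * s ≠ 0)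
    have e : (((x / y : ℝ) : ℂ) + s) = (x + y * s) / y := by
      push_cast
      field_simp
    simp only [dixonKernel]
    rw [mul_div_cancel_left₀ s hy.ne', e]
    push_cast
    field_simp
  have j := ip.add (ih.const_mul (θ : ℂ))
  constructor
  · have := integrableOn_Ioi_comp_mul_left_iff
      (fun z : ℝ => dixonKernel α θ z y / ((x : ℂ) + z)) 0 hy
    rw [mul_zero] at this
    rw [← this, integrableOn_congr_fun hfun measurableSet_Ioi]
    exact j.const_mul _
  · have := integral_comp_mul_left_Ioi
      (fun z : ℝ => dixonKernel α θ z y / ((x : ℂ) + z)) 0 hy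
    rw [mul_zero, setIntegral_congr_fun measurableSet_Ioi hfun, integral_const_mul,
      integral_add ip (ih.const_mul _), integral_const_mul, ep, eh, eq_inv_smul_iff₀ hy.ne',
      Complex.real_smul] at this
    rw [← this, dixonKernel]
    have e : (((x / y : ℝ) : ℂ) + 1) = (x + y) / y := by
      push_cast
      field_simp
    rw [e]
    generalize powDiff α (x / y) / (((x / y : ℝ) : ℂ) ^ 2 - 1) = r
    generalize (Real.pi : ℂ) / Complex.sin (Real.pi * α) = P
    field_simp
    ring

theorem dixonKernel_zero_eq_one_swap (α : ℂ) {x y : ℝ} (hx : 0 < x) (hy : 0 < y) :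
    dixonKernel α 0 x y = dixonKernel α 1 y x := by
  have hs : 0 < y / x := by positivity
  have hxc : (x : ℂ) ≠ 0 := by exact_mod_cast hx.ne'
  have hyc : (y : ℂ) ≠ 0 := by exact_mod_cast hy.ne'
  rcases eq_or_ne x y with rfl | hxy
  · simp [dixonKernel, hx.ne', powDiff_one]
  have d1 : (x : ℂ) ^ 2 - y ^ 2 ≠ 0 := by
    have : x ^ 2 ≠ y ^ 2 := fun h => hxy ((sq_eq_sq₀ hx.le hy.le).1 h)
    exact sub_ne_zero.2 (by exact_mod_cast this)
  have d2 : (y : ℂ) ^ 2 - x ^ 2 ≠ 0 := by rw [← neg_sub]; exact neg_ne_zero.2 d1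
  have e1 : ((x : ℂ) / y) ^ 2 - 1 = (x ^ 2 - y ^ 2) / y ^ 2 := by field_simp
  have e2 : ((y : ℂ) / x) ^ 2 - 1 = (y ^ 2 - x ^ 2) / x ^ 2 := by field_simp
  unfold dixonKernel
  rw [show x / y = (y / x)⁻¹ by rw [inv_div], powDiff_inv α hs, inv_div]
  push_cast
  rw [e1, e2, ← neg_sub ((y : ℂ) ^ 2)]
  field_simp
  ring

theorem dixonKernel_eq_add (α : ℂ) (θ : ℝ) {x y : ℝ} (hx : 0 < x) (hy : 0 < y) :
    dixonKernel α θ x y = dixonKernel α 0 x y +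
      θ * ((x : ℂ) ^ (-α) * (y : ℂ) ^ (-(1 - α)) - (x : ℂ) ^ (α - 1) * (y : ℂ) ^ (-α)) := by
  have hyc : (y : ℂ) ≠ 0 := by exact_mod_cast hy.ne'
  have h1 : (y : ℂ) ^ (-(1 - α)) = (y : ℂ)⁻¹ * (y : ℂ) ^ α := by
    rw [show -(1 - α) = -1 + α by ring, Complex.cpow_add _ _ hyc, Complex.cpow_neg_one]
  have h2 : (y : ℂ) ^ (-(α - 1)) = (y : ℂ) * (y : ℂ) ^ (-α) := by
    rw [show -(α - 1) = 1 + -α by ring, Complex.cpow_add _ _ hyc, Complex.cpow_one]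
  unfold dixonKernel powDiff
  rw [div_eq_mul_inv x y, cpow_mul_pos hx (inv_pos.2 hy), cpow_mul_pos hx (inv_pos.2 hy),
    cpow_inv_pos hy, cpow_inv_pos hy, neg_neg, h1, h2]
  push_cast
  field_simp
  ring

theorem exists_norm_resolvent_profile_le (α : ℂ) :
    ∃ C : ℝ, 0 < C ∧ ∀ s : ℝ, 0 < s →
      ‖powDiff α s / ((s : ℂ) ^ 2 - 1)‖ ≤ C * (powSum α.re s / (1 + s) ^ 2) := by
  obtain ⟨C, hC, h⟩ := exists_norm_powDiff_le α
  refine ⟨C, hC, fun s hs => ?_⟩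
  have hp := powSum_nonneg α.re hs
  have e : ‖(s : ℂ) ^ 2 - 1‖ = |s - 1| * (1 + s) := by
    rw [show (s : ℂ) ^ 2 - 1 = (((s - 1) * (1 + s) : ℝ) : ℂ) by push_cast; ring,
      Complex.norm_real, Real.norm_eq_abs, abs_mul, abs_of_pos (by positivity : 0 < 1 + s)]
  rw [norm_div, e]
  refine div_le_of_le_mul₀ (by positivity) (by positivity) ((h s hs).trans_eq ?_)
  field_simp

/-- The second weight `θ = φ₂` of an admissible pair, with explicit constant. -/
structure IsCutoff (θ : ℝ → ℝ) (D : ℝ) : Prop where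
  aesm : AEStronglyMeasurable θ (volume.restrict (Ioi 0))
  nonneg : ∀ y, 0 < y → 0 ≤ θ y
  le_one : ∀ y, 0 < y → θ y ≤ 1
  le_mul : ∀ y, 0 < y → θ y ≤ D * (y / (1 + y))
  one_sub_le : ∀ y, 0 < y → 1 - θ y ≤ D * (1 / (1 + y))

theorem IsCutoff.const_pos {θ : ℝ → ℝ} {D : ℝ} (h : IsCutoff θ D) : 0 < D := by
  have h1 := h.le_mul 1 one_pos
  have h2 := h.one_sub_le 1 one_pos
  norm_num at h1 h2
  linarith

theorem norm_one_add_ofReal {y : ℝ} (hy : 0 < y) : ‖1 + (y : ℂ)‖ = 1 + y := by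
  rw [show (1 : ℂ) + y = ((1 + y : ℝ) : ℂ) by push_cast; rfl, Complex.norm_real,
    Real.norm_eq_abs, abs_of_pos (by positivity)]

theorem norm_ofReal_add_ofReal {x y : ℝ} (hx : 0 < x) (hy : 0 < y) :
    ‖(x : ℂ) + (y : ℂ)‖ = x + y := by
  rw [← Complex.ofReal_add, Complex.norm_real, Real.norm_eq_abs, abs_of_pos (by positivity)]

theorem IsCutoff.exists_norm_dixonKernel_le {θ : ℝ → ℝ} {D : ℝ} (hθ : IsCutoff θ D) (α : ℂ) :
    ∃ C : ℝ, 0 < C ∧ ∀ x y : ℝ, 0 < x → 0 < y → ‖dixonKernel α (θ y) x y‖ ≤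
      C * (y⁻¹ * ((1 + y * (x / y) ^ 2) / (1 + y) * (powSum α.re (x / y) / (1 + x / y) ^ 2))) := by
  obtain ⟨C, hC, h⟩ := exists_norm_resolvent_profile_le α
  have hD := hθ.const_pos
  refine ⟨D * C, by positivity, fun x y hx hy => ?_⟩
  have hs : 0 < x / y := by positivity
  have e : dixonKernel α (θ y) x y = ((y⁻¹ * ((1 - θ y) + θ y * (x / y) ^ 2) : ℝ) : ℂ) *
      (powDiff α (x / y) / (((x / y : ℝ) : ℂ) ^ 2 - 1)) := by
    unfold dixonKernel
    rcases eq_or_ne (x / y) 1 with h1 | h1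
    · rw [h1, powDiff_one]; simp
    have hne : ((x / y : ℝ) : ℂ) ^ 2 - 1 ≠ 0 := by
      have : (x / y) ^ 2 ≠ 1 := fun h => h1 ((pow_eq_one_iff_of_nonneg hs.le two_ne_zero).1 h)
      exact sub_ne_zero.2 (by exact_mod_cast this)
    generalize x / y = s at *
    push_cast
    field_simp
    ring
  have n1 : 0 ≤ 1 - θ y := by linarith [hθ.le_one y hy]
  have n2 := hθ.nonneg y hy
  have b : (1 - θ y) + θ y * (x / y) ^ 2 ≤ D * ((1 + y * (x / y) ^ 2) / (1 + y)) := by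
    calc (1 - θ y) + θ y * (x / y) ^ 2
        ≤ D * (1 / (1 + y)) + D * (y / (1 + y)) * (x / y) ^ 2 := by
          gcongr
          · exact hθ.one_sub_le y hy
          · exact hθ.le_mul y hy
      _ = _ := by field_simp
  rw [e, norm_mul, Complex.norm_real, Real.norm_eq_abs, abs_of_nonneg (by positivity)]
  have hp := powSum_nonneg α.re hs
  calc _ ≤ (y⁻¹ * (D * ((1 + y * (x / y) ^ 2) / (1 + y)))) *
        (C * (powSum α.re (x / y) / (1 + x / y) ^ 2)) := by
        gcongr
        exact h _ hs
    _ = _ := by ring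

theorem IsCutoff.exists_norm_dixonKernel_div_add_le {θ : ℝ → ℝ} {D : ℝ} (hθ : IsCutoff θ D)
    (α : ℂ) {x : ℝ} (hx : 0 < x) :
    ∃ C : ℝ, 0 < C ∧ ∀ z y : ℝ, 0 < z → 0 < y → ‖dixonKernel α (θ y) z y / ((x : ℂ) + z)‖ ≤
      C / (1 + y) * (y⁻¹ * (powSum α.re (z / y) / (1 + z / y))) := by
  obtain ⟨C, hC, h⟩ := hθ.exists_norm_dixonKernel_le α
  refine ⟨C * (1 / x + 1), by positivity, fun z y hz hy => ?_⟩
  have hs : 0 < z / y := by positivity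
  have hp := powSum_nonneg α.re hs
  rw [norm_div, norm_ofReal_add_ofReal hx hz]
  refine div_le_of_le_mul₀ (by positivity) (by positivity) ((h z y hz hy).trans ?_)
  obtain ⟨s, rfl⟩ : ∃ s, z = y * s := ⟨z / y, by field_simp⟩
  rw [mul_div_cancel_left₀ s hy.ne'] at hs hp ⊢
  have key : 1 + y * s ^ 2 ≤ (1 / x + 1) * (1 + s) * (x + y * s) := by
    have : (1 / x + 1) * (1 + s) * (x + y * s) =
        1 + y * s ^ 2 + (s + y * s / x + y * s ^ 2 / x + x + x * s + y * s) := by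
      field_simp
      ring
    rw [this]
    have : 0 ≤ s + y * s / x + y * s ^ 2 / x + x + x * s + y * s := by positivity
    linarith
  calc _ ≤ C * (y⁻¹ * (((1 / x + 1) * (1 + s) * (x + y * s)) / (1 + y) *
        (powSum α.re s / (1 + s) ^ 2))) := by gcongr
    _ = _ := by field_simp

theorem powSum_div_le (a : ℝ) {x y : ℝ} (hx : 0 < x) (hy : 0 < y) :
    powSum a (x / y) ≤ powSum a x * (y * powSum a y) := by
  have e : y * powSum a y = y ^ a + y ^ (1 - a) + (y * y ^ (-a) - y ^ (1 - a)) +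
      (y * y ^ (a - 1) - y ^ a) := by unfold powSum; ring
  have e1 : y * y ^ (-a) = y ^ (1 - a) := by
    rw [sub_eq_add_neg, Real.rpow_add hy, Real.rpow_one]
  have e2 : y * y ^ (a - 1) = y ^ a := by
    rw [Real.rpow_sub hy, Real.rpow_one]; field_simp
  rw [e, e1, e2]
  unfold powSum
  rw [Real.div_rpow hx.le hy.le, Real.div_rpow hx.le hy.le, Real.rpow_neg hy.le a,
    ← neg_sub 1 a, Real.rpow_neg hy.le (1 - a), div_inv_eq_mul, div_inv_eq_mul]
  have h1 : 0 ≤ x ^ (-a) * y ^ (1 - a) := by positivity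
  have h2 : 0 ≤ x ^ (-(1 - a)) * y ^ a := by positivity
  nlinarith

theorem rpow_le_one_add {y b : ℝ} (hy : 0 < y) (h0 : 0 ≤ b) (h1 : b ≤ 1) : y ^ b ≤ 1 + y := by
  rcases le_total y 1 with h | h
  · linarith [Real.rpow_le_one hy.le h h0]
  · have := Real.rpow_le_rpow_of_exponent_le h h1
    rw [Real.rpow_one] at this
    linarith

theorem mul_powSum_le {a y : ℝ} (h0 : 0 ≤ a) (h1 : a ≤ 1) (hy : 0 < y) :
    y * powSum a y ≤ 2 * (1 + y) := by
  have e1 : y * y ^ (-a) = y ^ (1 - a) := by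
    rw [sub_eq_add_neg, Real.rpow_add hy, Real.rpow_one]
  have e2 : y * y ^ (a - 1) = y ^ a := by
    rw [Real.rpow_sub hy, Real.rpow_one]; field_simp
  rw [powSum, mul_add, e1, e2]
  linarith [rpow_le_one_add hy h0 h1, rpow_le_one_add (b := 1 - a) hy (by linarith) (by linarith)]

theorem IsCutoff.exists_norm_dixonKernel_le_powSum {θ : ℝ → ℝ} {D : ℝ} (hθ : IsCutoff θ D)
    (α : ℂ) {x : ℝ} (hx : 0 < x) :
    ∃ C : ℝ, 0 < C ∧ ∀ y : ℝ, 0 < y →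
      ‖dixonKernel α (θ y) x y‖ ≤ C * (y * powSum α.re y / (1 + y) ^ 2) := by
  obtain ⟨C, hC, h⟩ := hθ.exists_norm_dixonKernel_le α
  have hpx : 0 < powSum α.re x := by unfold powSum; positivity
  refine ⟨C * ((1 + x) * (1 + 1 / x) * powSum α.re x), by positivity, fun y hy => ?_⟩
  refine (h x y hx hy).trans ?_
  have hs : 0 < x / y := by positivity
  have hp := powSum_nonneg α.re hs
  have hpy := powSum_nonneg α.re hy
  have k1 : y⁻¹ * ((1 + y * (x / y) ^ 2) / (1 + y)) / (1 + x / y) ^ 2 ≤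
      (1 + x) * (1 + 1 / x) / (1 + y) ^ 2 := by
    have k : (y + x ^ 2) * (1 + y) ≤ (1 + x) * (1 + 1 / x) * (x + y) ^ 2 := by
      have k2 : y + x ^ 2 ≤ (1 + x) * (x + y) := by nlinarith [mul_pos hx hy]
      have k3 : 1 + y ≤ (1 + 1 / x) * (x + y) := by
        have : (1 + 1 / x) * (x + y) = 1 + y + (x + y / x) := by field_simp; ring
        rw [this]
        have : 0 ≤ x + y / x := by positivity
        linarith
      calc _ ≤ ((1 + x) * (x + y)) * ((1 + 1 / x) * (x + y)) := by gcongr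
        _ = _ := by ring
    have e : y⁻¹ * ((1 + y * (x / y) ^ 2) / (1 + y)) / (1 + x / y) ^ 2 =
        (y + x ^ 2) / ((1 + y) * (x + y) ^ 2) := by
      field_simp
      ring
    rw [e, div_le_div_iff₀ (by positivity) (by positivity)]
    calc (y + x ^ 2) * (1 + y) ^ 2 = ((y + x ^ 2) * (1 + y)) * (1 + y) := by ring
      _ ≤ ((1 + x) * (1 + 1 / x) * (x + y) ^ 2) * (1 + y) := by gcongr
      _ = _ := by ring
  calc C * (y⁻¹ * ((1 + y * (x / y) ^ 2) / (1 + y) *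
        (powSum α.re (x / y) / (1 + x / y) ^ 2)))
      = C * ((y⁻¹ * ((1 + y * (x / y) ^ 2) / (1 + y)) / (1 + x / y) ^ 2) *
        powSum α.re (x / y)) := by ring
    _ ≤ C * ((1 + x) * (1 + 1 / x) / (1 + y) ^ 2 * (powSum α.re x * (y * powSum α.re y))) := by
        gcongr
        exact powSum_div_le _ hx hy
    _ = _ := by ring

theorem IsCutoff.exists_norm_dixonKernel_le_inv {θ : ℝ → ℝ} {D : ℝ} (hθ : IsCutoff θ D)
    {α : ℂ} (h0 : 0 < α.re) (h1 : α.re < 1) {x : ℝ} (hx : 0 < x) :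
    ∃ C : ℝ, 0 < C ∧ ∀ y : ℝ, 0 < y → ‖dixonKernel α (θ y) x y‖ ≤ C / (1 + y) := by
  obtain ⟨C, hC, h⟩ := hθ.exists_norm_dixonKernel_le_powSum α hx
  refine ⟨C * 2, by positivity, fun y hy => (h y hy).trans ?_⟩
  calc C * (y * powSum α.re y / (1 + y) ^ 2) ≤ C * (2 * (1 + y) / (1 + y) ^ 2) :=
        mul_le_mul_of_nonneg_left
          (div_le_div_of_nonneg_right (mul_powSum_le h0.le h1.le hy) (by positivity)) hC.le
    _ = _ := by field_simp

theorem measurable_powDiff (α : ℂ) : Measurable (powDiff α) := by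
  unfold powDiff
  fun_prop

theorem IsCutoff.aestronglyMeasurable_dixonKernel {θ : ℝ → ℝ} {D : ℝ} (hθ : IsCutoff θ D)
    (α : ℂ) :
    AEStronglyMeasurable (fun p : ℝ × ℝ => dixonKernel α (θ p.2) p.1 p.2)
      ((volume.restrict (Ioi 0)).prod (volume.restrict (Ioi 0))) := by
  have hd : Measurable fun p : ℝ × ℝ => powDiff α (p.1 / p.2) :=
    (measurable_powDiff α).comp (by fun_prop)
  have hθ2 : AEStronglyMeasurable (fun p : ℝ × ℝ => ((θ p.2 : ℝ) : ℂ))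
      ((volume.restrict (Ioi 0)).prod (volume.restrict (Ioi 0))) :=
    Complex.continuous_ofReal.comp_aestronglyMeasurable hθ.aesm.comp_snd
  unfold dixonKernel
  refine AEStronglyMeasurable.mul (Measurable.aestronglyMeasurable (by fun_prop)) (.add ?_ ?_)
  · exact (hd.div (by fun_prop)).aestronglyMeasurable
  · exact hθ2.mul hd.aestronglyMeasurable

theorem IsCutoff.aestronglyMeasurable_dixonKernel_left {θ : ℝ → ℝ} {D : ℝ}
    (hθ : IsCutoff θ D) (α : ℂ) (x : ℝ) :
    AEStronglyMeasurable (fun y : ℝ => dixonKernel α (θ y) x y) (volume.restrict (Ioi 0)) := by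
  have hd : Measurable fun y : ℝ => powDiff α (x / y) :=
    (measurable_powDiff α).comp (by fun_prop)
  unfold dixonKernel
  refine AEStronglyMeasurable.mul (Measurable.aestronglyMeasurable (by fun_prop)) (.add ?_ ?_)
  · exact (hd.div (by fun_prop)).aestronglyMeasurable
  · exact (Complex.continuous_ofReal.comp_aestronglyMeasurable hθ.aesm).mul
      hd.aestronglyMeasurable

theorem MemE.aestronglyMeasurable {f : ℝ → ℂ} (hf : MemE f) :
    AEStronglyMeasurable f (volume.restrict (Ioi 0)) := by
  have h1 : AEStronglyMeasurable (fun x : ℝ => (1 + (x : ℂ))) (volume.restrict (Ioi 0)) :=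
    Continuous.aestronglyMeasurable (by fun_prop)
  have hi : Integrable _ (volume.restrict (Ioi (0 : ℝ))) := hf
  refine (hi.aestronglyMeasurable.mul h1).congr ?_
  filter_upwards [ae_restrict_mem measurableSet_Ioi] with x hx
  have hx : 0 < x := hx
  have hc : (1 : ℂ) + x ≠ 0 := by exact_mod_cast (by positivity : 1 + x ≠ 0)
  simp [hc]

theorem MemE.integrableOn_norm_div {f : ℝ → ℂ} (hf : MemE f) :
    IntegrableOn (fun x : ℝ => ‖f x‖ / (1 + x)) (Ioi 0) := by
  refine (integrableOn_congr_fun (fun x hx => ?_) measurableSet_Ioi).1 hf.norm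
  simp only [norm_div]
  rw [norm_one_add_ofReal hx]

theorem MemE.integrableOn_mul {f : ℝ → ℂ} (hf : MemE f) {k : ℝ → ℂ}
    (hk : AEStronglyMeasurable k (volume.restrict (Ioi 0))) {C : ℝ}
    (hC : ∀ y, 0 < y → ‖k y‖ ≤ C / (1 + y)) :
    IntegrableOn (fun y => k y * f y) (Ioi 0) := by
  refine (hf.integrableOn_norm_div.const_mul C).mono' (hk.mul hf.aestronglyMeasurable) ?_
  filter_upwards [ae_restrict_mem measurableSet_Ioi] with y hy
  rw [norm_mul]
  calc ‖k y‖ * ‖f y‖ ≤ C / (1 + y) * ‖f y‖ := by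
        gcongr
        exact hC y hy
    _ = _ := by ring

theorem one_div_add_le {x y : ℝ} (hx : 0 < x) (hy : 0 < y) :
    1 / (x + y) ≤ (1 + 1 / x) / (1 + y) := by
  rw [div_le_div_iff₀ (by positivity) (by positivity)]
  have : (1 + 1 / x) * (x + y) = 1 + y + (x + y / x) := by field_simp; ring
  rw [this]
  have : 0 ≤ x + y / x := by positivity
  linarith

theorem aestronglyMeasurable_one_div_add (x : ℝ) :
    AEStronglyMeasurable (fun y : ℝ => 1 / ((x : ℂ) + y)) (volume.restrict (Ioi 0)) :=
  Measurable.aestronglyMeasurable (by fun_prop)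

theorem norm_one_div_add_le {x y : ℝ} (hx : 0 < x) (hy : 0 < y) :
    ‖1 / ((x : ℂ) + y)‖ ≤ (1 + 1 / x) / (1 + y) := by
  rw [norm_div, norm_one, norm_ofReal_add_ofReal hx hy]
  exact one_div_add_le hx hy

theorem MemE.integrableOn_div_add {f : ℝ → ℂ} (hf : MemE f) {x : ℝ} (hx : 0 < x) :
    IntegrableOn (fun y : ℝ => f y / ((x : ℂ) + y)) (Ioi 0) := by
  refine (hf.integrableOn_mul (aestronglyMeasurable_one_div_add x)
    (fun y hy => norm_one_div_add_le hx hy)).congr (ae_of_all _ fun y => ?_)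
  simp only
  ring

theorem MemE.integrableOn_dixonKernel_mul {f : ℝ → ℂ} (hf : MemE f) {θ : ℝ → ℝ} {D : ℝ}
    (hθ : IsCutoff θ D) {α : ℂ} (h0 : 0 < α.re) (h1 : α.re < 1) {x : ℝ} (hx : 0 < x) :
    IntegrableOn (fun y : ℝ => dixonKernel α (θ y) x y * f y) (Ioi 0) := by
  obtain ⟨C, -, hC⟩ := hθ.exists_norm_dixonKernel_le_inv h0 h1 hx
  exact hf.integrableOn_mul (hθ.aestronglyMeasurable_dixonKernel_left α x) hC

theorem integral_inv_mul_comp_div {F : ℝ → ℝ} {y : ℝ} (hy : 0 < y) :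
    ∫ z in Ioi (0 : ℝ), y⁻¹ * F (z / y) = ∫ s in Ioi (0 : ℝ), F s := by
  have := integral_comp_mul_left_Ioi F 0 (inv_pos.2 hy)
  rw [mul_zero, inv_inv, smul_eq_mul] at this
  rw [integral_const_mul]
  simp_rw [div_eq_inv_mul]
  rw [this]
  field_simp

theorem IsCutoff.integrable_prod_div_add {θ : ℝ → ℝ} {D : ℝ} (hθ : IsCutoff θ D)
    {α : ℂ} (h0 : 0 < α.re) (h1 : α.re < 1) {g : ℝ → ℂ} (hg : MemE g) {x : ℝ} (hx : 0 < x) :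
    Integrable (fun p : ℝ × ℝ => dixonKernel α (θ p.2) p.1 p.2 / ((x : ℂ) + p.1) * g p.2)
      ((volume.restrict (Ioi 0)).prod (volume.restrict (Ioi 0))) := by
  obtain ⟨C, hC, h⟩ := hθ.exists_norm_dixonKernel_div_add_le α hx
  have hmeas : AEStronglyMeasurable
      (fun p : ℝ × ℝ => dixonKernel α (θ p.2) p.1 p.2 / ((x : ℂ) + p.1) * g p.2)
      ((volume.restrict (Ioi 0)).prod (volume.restrict (Ioi 0))) := by
    simp_rw [div_eq_mul_inv]
    exact ((hθ.aestronglyMeasurable_dixonKernel α).mul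
      (Measurable.aestronglyMeasurable (by fun_prop))).mul hg.aestronglyMeasurable.comp_snd
  have hae : ∀ᵐ y ∂(volume.restrict (Ioi (0 : ℝ))), y ≠ x :=
    ae_restrict_of_ae (Measure.ae_ne volume x)
  have hsec : ∀ᵐ y ∂(volume.restrict (Ioi (0 : ℝ))),
      IntegrableOn (fun z : ℝ => dixonKernel α (θ y) z y / ((x : ℂ) + z) * g y) (Ioi 0) := by
    filter_upwards [ae_restrict_mem measurableSet_Ioi, hae] with y hy hyx
    exact (integral_dixonKernel_div_add h0 h1 (θ y) hx hy hyx.symm).1.mul_const _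
  refine (integrable_prod_iff' hmeas).2 ⟨hsec, ?_⟩
  have hW := integrableOn_powSum_div h0 h1
  set J := ∫ s in Ioi (0 : ℝ), powSum α.re s / (1 + s) with hJ
  refine (hg.integrableOn_norm_div.const_mul (C * J)).mono'
    hmeas.norm.prod_swap.integral_prod_right' ?_
  filter_upwards [ae_restrict_mem measurableSet_Ioi, hsec] with y hy hysec
  have hy : 0 < y := hy
  have hWy : IntegrableOn (fun z : ℝ => y⁻¹ * (powSum α.re (z / y) / (1 + z / y))) (Ioi 0) := by
    have := (integrableOn_Ioi_comp_mul_left_iff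
      (fun s : ℝ => powSum α.re s / (1 + s)) 0 (inv_pos.2 hy)).2 (by simpa using hW)
    refine (this.const_mul y⁻¹).congr (ae_of_all _ fun z => ?_)
    simp only [div_eq_inv_mul z y]
  rw [Real.norm_eq_abs, abs_of_nonneg (integral_nonneg fun _ => norm_nonneg _)]
  calc ∫ z in Ioi (0 : ℝ), ‖dixonKernel α (θ y) z y / ((x : ℂ) + z) * g y‖
      ≤ ∫ z in Ioi (0 : ℝ), C / (1 + y) * ‖g y‖ *
          (y⁻¹ * (powSum α.re (z / y) / (1 + z / y))) := by
        refine setIntegral_mono_on hysec.norm (hWy.const_mul _) measurableSet_Ioi fun z hz => ?_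
        rw [norm_mul]
        calc _ ≤ C / (1 + y) * (y⁻¹ * (powSum α.re (z / y) / (1 + z / y))) * ‖g y‖ := by
              gcongr
              exact h z y hz hy
          _ = _ := by ring
    _ = C / (1 + y) * ‖g y‖ * J := by
        rw [integral_const_mul,
          integral_inv_mul_comp_div (F := fun s => powSum α.re s / (1 + s)) hy]
    _ = _ := by ring

theorem IsCutoff.integral_dixon_div_add {θ : ℝ → ℝ} {D : ℝ} (hθ : IsCutoff θ D)
    {α : ℂ} (h0 : 0 < α.re) (h1 : α.re < 1) {g : ℝ → ℂ} (hg : MemE g) {x : ℝ} (hx : 0 < x) :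
    IntegrableOn (fun z : ℝ => (∫ y in Ioi (0 : ℝ), dixonKernel α (θ y) z y * g y) /
      ((x : ℂ) + z)) (Ioi 0) ∧
    ∫ z in Ioi (0 : ℝ), (∫ y in Ioi (0 : ℝ), dixonKernel α (θ y) z y * g y) / ((x : ℂ) + z) =
      (Real.pi : ℂ) / Complex.sin (Real.pi * α) *
        (∫ y in Ioi (0 : ℝ), dixonKernel α (θ y) x y * g y) +
      Real.pi * Complex.cot (Real.pi * α) * ∫ y in Ioi (0 : ℝ), g y / ((x : ℂ) + y) := by
  have hint := hθ.integrable_prod_div_add h0 h1 hg hx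
  have hinner : ∀ z : ℝ, ∫ y in Ioi (0 : ℝ), dixonKernel α (θ y) z y / ((x : ℂ) + z) * g y =
      (∫ y in Ioi (0 : ℝ), dixonKernel α (θ y) z y * g y) / ((x : ℂ) + z) := by
    intro z
    rw [← integral_div]
    congr 1
    funext y
    ring
  have hae : ∀ᵐ y ∂(volume.restrict (Ioi (0 : ℝ))), y ≠ x :=
    ae_restrict_of_ae (Measure.ae_ne volume x)
  constructor
  · refine hint.integral_prod_left.congr (ae_of_all _ fun z => ?_)
    exact hinner z
  · simp_rw [← hinner]
    rw [integral_integral_swap hint]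
    rw [← integral_const_mul, ← integral_const_mul, ← integral_add
      ((hg.integrableOn_dixonKernel_mul hθ h0 h1 hx).const_mul _)
      ((hg.integrableOn_div_add hx).const_mul _)]
    refine integral_congr_ae ?_
    filter_upwards [ae_restrict_mem measurableSet_Ioi, hae] with y hy hyx
    rw [integral_mul_const, (integral_dixonKernel_div_add h0 h1 (θ y) hx hy hyx.symm).2]
    ring

theorem IsCutoff.integrableOn_mul_cpow_div_add {θ : ℝ → ℝ} {D : ℝ} (hθ : IsCutoff θ D) {β : ℂ}
    (h0 : 0 < β.re) (h1 : β.re < 1) {z : ℝ} (hz : 0 < z) :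
    IntegrableOn (fun y : ℝ => (θ y : ℂ) * (y : ℂ) ^ (-β) / ((z : ℂ) + y)) (Ioi 0) := by
  have hm : AEStronglyMeasurable (fun y : ℝ => (θ y : ℂ)) (volume.restrict (Ioi 0)) :=
    Complex.continuous_ofReal.comp_aestronglyMeasurable hθ.aesm
  have hi : Integrable _ (volume.restrict (Ioi (0 : ℝ))) := integrableOn_cpow_div_add h0 h1 hz
  refine (hi.bdd_mul (c := 1) hm ?_).congr (ae_of_all _ fun y => ?_)
  · filter_upwards [ae_restrict_mem measurableSet_Ioi] with y hy
    rw [Complex.norm_real, Real.norm_eq_abs, abs_of_nonneg (hθ.nonneg y hy)]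
    exact hθ.le_one y hy
  · simp only
    ring

/-- The failure of the Stieltjes transform to act on `θ(y) y^{-β}` as it does on `y^{-β}`. -/
def cutoffDefect (θ : ℝ → ℝ) (β : ℂ) (z : ℝ) : ℂ :=
  (∫ y in Ioi (0 : ℝ), (θ y : ℂ) * (y : ℂ) ^ (-β) / ((z : ℂ) + y)) -
    (Real.pi : ℂ) / Complex.sin (Real.pi * β) * (θ z * (z : ℂ) ^ (-β))

theorem IsCutoff.aestronglyMeasurable_cutoffDefect {θ : ℝ → ℝ} {D : ℝ} (hθ : IsCutoff θ D)
    (β : ℂ) : AEStronglyMeasurable (cutoffDefect θ β) (volume.restrict (Ioi 0)) := by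
  have hm : AEStronglyMeasurable (fun y : ℝ => (θ y : ℂ)) (volume.restrict (Ioi 0)) :=
    Complex.continuous_ofReal.comp_aestronglyMeasurable hθ.aesm
  have h2 : AEStronglyMeasurable
      (fun p : ℝ × ℝ => (θ p.2 : ℂ) * (p.2 : ℂ) ^ (-β) / ((p.1 : ℂ) + p.2))
      ((volume.restrict (Ioi 0)).prod (volume.restrict (Ioi 0))) := by
    simp_rw [div_eq_mul_inv]
    exact (hm.comp_snd.mul (Measurable.aestronglyMeasurable (by fun_prop))).mul
      (Measurable.aestronglyMeasurable (by fun_prop))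
  unfold cutoffDefect
  refine h2.integral_prod_right'.sub (AEStronglyMeasurable.const_mul ?_ _)
  exact hm.mul (Measurable.aestronglyMeasurable (by fun_prop))

theorem norm_integral_mul_cpow_div_add_le {w : ℝ → ℝ} {β : ℂ} (h0 : 0 < β.re) (h1 : β.re < 1)
    {z C : ℝ} (hz : 0 < z) (hw : ∀ y, 0 < y → 0 ≤ w y)
    (hC : ∀ y, 0 < y → w y / (z + y) ≤ C * (1 / (1 + y))) :
    ‖∫ y in Ioi (0 : ℝ), (w y : ℂ) * (y : ℂ) ^ (-β) / ((z : ℂ) + y)‖ ≤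
      C * ∫ y in Ioi (0 : ℝ), y ^ (-β.re) / (1 + y) := by
  rw [← integral_const_mul]
  refine norm_integral_le_of_norm_le ((integrableOn_rpow_div_one_add h0 h1).const_mul C) ?_
  filter_upwards [ae_restrict_mem measurableSet_Ioi] with y hy
  have hy : 0 < y := hy
  rw [norm_div, norm_mul, norm_ofReal_add_ofReal hz hy, Complex.norm_real, Real.norm_eq_abs,
    abs_of_nonneg (hw y hy), Complex.norm_cpow_eq_rpow_re_of_pos hy, Complex.neg_re]
  calc w y * y ^ (-β.re) / (z + y) = w y / (z + y) * y ^ (-β.re) := by ring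
    _ ≤ C * (1 / (1 + y)) * y ^ (-β.re) := by gcongr; exact hC y hy
    _ = _ := by ring

theorem mul_rpow_neg_le {b z : ℝ} (h0 : 0 ≤ b) (h1 : b ≤ 1) (hz : 0 < z) :
    z * z ^ (-b) ≤ 1 + z := by
  have e : z * z ^ (-b) = z ^ (1 - b) := by
    rw [sub_eq_add_neg, Real.rpow_add hz, Real.rpow_one]
  rw [e]
  exact rpow_le_one_add hz (by linarith) (by linarith)

theorem IsCutoff.cutoffDefect_eq_neg {θ : ℝ → ℝ} {D : ℝ} (hθ : IsCutoff θ D) {β : ℂ}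
    (h0 : 0 < β.re) (h1 : β.re < 1) {z : ℝ} (hz : 0 < z) :
    cutoffDefect θ β z = -cutoffDefect (fun y => 1 - θ y) β z := by
  have e : ∀ y : ℝ, ((1 - θ y : ℝ) : ℂ) * (y : ℂ) ^ (-β) / ((z : ℂ) + y) =
      (y : ℂ) ^ (-β) / ((z : ℂ) + y) - (θ y : ℂ) * (y : ℂ) ^ (-β) / ((z : ℂ) + y) := by
    intro y
    push_cast
    ring
  unfold cutoffDefect
  simp_rw [e]
  rw [integral_sub (integrableOn_cpow_div_add h0 h1 hz)
    (hθ.integrableOn_mul_cpow_div_add h0 h1 hz), integral_cpow_div_add h0 h1 hz]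
  push_cast
  ring

theorem IsCutoff.norm_cutoffDefect_le {θ : ℝ → ℝ} {D : ℝ} (hθ : IsCutoff θ D) {β : ℂ}
    (h0 : 0 < β.re) (h1 : β.re < 1) :
    ∃ C : ℝ, ∀ z : ℝ, 0 < z → ‖cutoffDefect θ β z‖ ≤ C / (1 + z) := by
  set J := ∫ y in Ioi (0 : ℝ), y ^ (-β.re) / (1 + y) with hJ
  set P := (Real.pi : ℂ) / Complex.sin (Real.pi * β) with hP
  have hD := hθ.const_pos
  refine ⟨2 * (D * (J + ‖P‖)), fun z hz => ?_⟩
  have hb := mul_rpow_neg_le h0.le h1.le hz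
  have hzb : 0 < z ^ (-β.re) := by positivity
  have term : ∀ (w : ℝ), 0 ≤ w → ‖P * (w * (z : ℂ) ^ (-β))‖ = ‖P‖ * (w * z ^ (-β.re)) := by
    intro w hw
    rw [norm_mul, norm_mul, Complex.norm_real, Real.norm_eq_abs, abs_of_nonneg hw,
      Complex.norm_cpow_eq_rpow_re_of_pos hz, Complex.neg_re]
  have near : ‖cutoffDefect θ β z‖ ≤ D * (J + ‖P‖) := by
    have k1 : θ z * z ^ (-β.re) ≤ D := by
      calc θ z * z ^ (-β.re) ≤ D * (z / (1 + z)) * z ^ (-β.re) := by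
            gcongr
            exact hθ.le_mul z hz
        _ = D * (z * z ^ (-β.re)) / (1 + z) := by ring
        _ ≤ D * (1 + z) / (1 + z) := by gcongr
        _ = D := by field_simp
    have k2 := norm_integral_mul_cpow_div_add_le (w := θ) (C := D) h0 h1 hz hθ.nonneg
      (fun y hy => by
        calc θ y / (z + y) ≤ D * (y / (1 + y)) / y := by
              have := hθ.nonneg y hy
              gcongr
              · exact hθ.le_mul y hy
              · linarith
          _ = _ := by field_simp)
    refine (norm_sub_le _ _).trans ?_
    rw [← hP, term _ (hθ.nonneg z hz), mul_add]
    refine add_le_add k2 ?_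
    rw [mul_comm D]
    gcongr
  have far : z * ‖cutoffDefect θ β z‖ ≤ D * (J + ‖P‖) := by
    have hw : ∀ y, 0 < y → 0 ≤ 1 - θ y := fun y hy => by linarith [hθ.le_one y hy]
    have k1 : z * ((1 - θ z) * z ^ (-β.re)) ≤ D := by
      calc z * ((1 - θ z) * z ^ (-β.re)) ≤ z * (D * (1 / (1 + z)) * z ^ (-β.re)) := by
            gcongr
            exact hθ.one_sub_le z hz
        _ = D * (z * z ^ (-β.re)) / (1 + z) := by ring
        _ ≤ D * (1 + z) / (1 + z) := by gcongr
        _ = D := by field_simp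
    have k2 := norm_integral_mul_cpow_div_add_le (w := fun y => 1 - θ y) (C := D / z) h0 h1 hz hw
      (fun y hy => by
        calc (1 - θ y) / (z + y) ≤ D * (1 / (1 + y)) / z := by
              have := hw y hy
              gcongr
              · exact hθ.one_sub_le y hy
              · linarith
          _ = _ := by ring)
    rw [hθ.cutoffDefect_eq_neg h0 h1 hz, norm_neg]
    have k3 : ‖cutoffDefect (fun y => 1 - θ y) β z‖ ≤
        D / z * J + ‖P‖ * ((1 - θ z) * z ^ (-β.re)) := by
      refine (norm_sub_le _ _).trans ?_
      rw [← hP, term _ (hw z hz)]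
      exact add_le_add k2 le_rfl
    calc z * ‖cutoffDefect (fun y => 1 - θ y) β z‖
        ≤ z * (D / z * J + ‖P‖ * ((1 - θ z) * z ^ (-β.re))) := by gcongr
      _ = D * J + ‖P‖ * (z * ((1 - θ z) * z ^ (-β.re))) := by field_simp
      _ ≤ D * J + ‖P‖ * D := by gcongr
      _ = _ := by ring
  rw [le_div_iff₀ (by positivity)]
  linarith

theorem sin_pi_mul_one_sub (α : ℂ) :
    Complex.sin (Real.pi * (1 - α)) = Complex.sin (Real.pi * α) := by
  rw [mul_sub, mul_one, Complex.sin_pi_sub]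

theorem IsCutoff.integral_dixonKernel_left_div_add {θ : ℝ → ℝ} {D : ℝ} (hθ : IsCutoff θ D)
    {α : ℂ} (h0 : 0 < α.re) (h1 : α.re < 1) {x z : ℝ} (hx : 0 < x) (hz : 0 < z) (hzx : z ≠ x) :
    ∫ y in Ioi (0 : ℝ), dixonKernel α (θ y) x y / ((z : ℂ) + y) =
      (Real.pi : ℂ) / Complex.sin (Real.pi * α) * dixonKernel α (θ z) x z +
        Real.pi * Complex.cot (Real.pi * α) / (x + z) +
        ((x : ℂ) ^ (-α) * cutoffDefect θ (1 - α) z - (x : ℂ) ^ (α - 1) * cutoffDefect θ α z) := by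
  have h0' : 0 < (1 - α).re := by simpa using h1
  have h1' : (1 - α).re < 1 := by simpa using h0
  have hK := integral_dixonKernel_div_add h0 h1 1 hz hx hzx
  have i1 := (hθ.integrableOn_mul_cpow_div_add h0' h1' hz).const_mul ((x : ℂ) ^ (-α))
  have i2 := (hθ.integrableOn_mul_cpow_div_add h0 h1 hz).const_mul ((x : ℂ) ^ (α - 1))
  have e : ∀ y ∈ Ioi (0 : ℝ), dixonKernel α (θ y) x y / ((z : ℂ) + y) =
      dixonKernel α 1 y x / ((z : ℂ) + y) +
        ((x : ℂ) ^ (-α) * ((θ y : ℂ) * (y : ℂ) ^ (-(1 - α)) / ((z : ℂ) + y)) -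
          (x : ℂ) ^ (α - 1) * ((θ y : ℂ) * (y : ℂ) ^ (-α) / ((z : ℂ) + y))) := by
    intro y hy
    rw [dixonKernel_eq_add α (θ y) hx hy, dixonKernel_zero_eq_one_swap α hx hy]
    ring
  have i12 : IntegrableOn (fun y : ℝ =>
      (x : ℂ) ^ (-α) * ((θ y : ℂ) * (y : ℂ) ^ (-(1 - α)) / ((z : ℂ) + y)) -
        (x : ℂ) ^ (α - 1) * ((θ y : ℂ) * (y : ℂ) ^ (-α) / ((z : ℂ) + y))) (Ioi 0) := i1.sub i2
  rw [setIntegral_congr_fun measurableSet_Ioi e, integral_add hK.1 i12, integral_sub i1 i2,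
    integral_const_mul, integral_const_mul, hK.2,
    dixonKernel_eq_add α (θ z) hx hz, dixonKernel_zero_eq_one_swap α hx hz]
  unfold cutoffDefect
  rw [sin_pi_mul_one_sub]
  ring

theorem IsCutoff.integrable_prod_dixonKernel_left {θ : ℝ → ℝ} {D : ℝ} (hθ : IsCutoff θ D)
    {α : ℂ} (h0 : 0 < α.re) (h1 : α.re < 1) {f : ℝ → ℂ} (hf : MemE f) {x : ℝ} (hx : 0 < x) :
    Integrable (fun p : ℝ × ℝ => dixonKernel α (θ p.1) x p.1 / ((p.2 : ℂ) + p.1) * f p.2)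
      ((volume.restrict (Ioi 0)).prod (volume.restrict (Ioi 0))) := by
  obtain ⟨C, hC, h⟩ := hθ.exists_norm_dixonKernel_le_powSum α hx
  have hmeas : AEStronglyMeasurable
      (fun p : ℝ × ℝ => dixonKernel α (θ p.1) x p.1 / ((p.2 : ℂ) + p.1) * f p.2)
      ((volume.restrict (Ioi 0)).prod (volume.restrict (Ioi 0))) := by
    simp_rw [div_eq_mul_inv]
    exact ((hθ.aestronglyMeasurable_dixonKernel_left α x).comp_fst.mul
      (Measurable.aestronglyMeasurable (by fun_prop))).mul hf.aestronglyMeasurable.comp_snd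
  have hW := (integrableOn_powSum_div h0 h1).const_mul C
  refine (Integrable.mul_prod hW hf.integrableOn_norm_div).mono' hmeas ?_
  rw [Measure.prod_restrict]
  filter_upwards [ae_restrict_mem (measurableSet_Ioi.prod measurableSet_Ioi)] with p hp
  obtain ⟨y, z⟩ := p
  have hy : 0 < y := hp.1
  have hz : 0 < z := hp.2
  have hs := powSum_nonneg α.re hy
  simp only [norm_mul, norm_div]
  rw [norm_ofReal_add_ofReal hz hy]
  have key : y / ((1 + y) * (z + y)) ≤ 1 / (1 + z) := by
    rw [div_le_div_iff₀ (by positivity) (by positivity)]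
    nlinarith [mul_pos hy hz]
  calc ‖dixonKernel α (θ y) x y‖ / (z + y) * ‖f z‖
      ≤ C * (y * powSum α.re y / (1 + y) ^ 2) / (z + y) * ‖f z‖ := by
        gcongr
        exact h y hy
    _ = C * (powSum α.re y / (1 + y)) * (y / ((1 + y) * (z + y)) * ‖f z‖) := by
        field_simp
    _ ≤ C * (powSum α.re y / (1 + y)) * (1 / (1 + z) * ‖f z‖) := by gcongr
    _ = _ := by ring

theorem IsCutoff.exists_integral_dixonKernel_mul_stieltjes {θ : ℝ → ℝ} {D : ℝ}
    (hθ : IsCutoff θ D) {α : ℂ} (h0 : 0 < α.re) (h1 : α.re < 1) {f : ℝ → ℂ} (hf : MemE f) :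
    ∃ A B : ℂ, ∀ x : ℝ, 0 < x →
      IntegrableOn (fun y : ℝ => dixonKernel α (θ y) x y *
        ∫ z in Ioi (0 : ℝ), f z / ((y : ℂ) + z)) (Ioi 0) ∧
      ∫ y in Ioi (0 : ℝ), dixonKernel α (θ y) x y * ∫ z in Ioi (0 : ℝ), f z / ((y : ℂ) + z) =
        (Real.pi : ℂ) / Complex.sin (Real.pi * α) *
          (∫ y in Ioi (0 : ℝ), dixonKernel α (θ y) x y * f y) +
        Real.pi * Complex.cot (Real.pi * α) * (∫ y in Ioi (0 : ℝ), f y / ((x : ℂ) + y)) +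
        A * (x : ℂ) ^ (-α) + B * (x : ℂ) ^ (α - 1) := by
  have h0' : 0 < (1 - α).re := by simpa using h1
  have h1' : (1 - α).re < 1 := by simpa using h0
  obtain ⟨C₁, hC₁⟩ := hθ.norm_cutoffDefect_le h0' h1'
  obtain ⟨C₂, hC₂⟩ := hθ.norm_cutoffDefect_le h0 h1
  have u1 := hf.integrableOn_mul (hθ.aestronglyMeasurable_cutoffDefect (1 - α)) hC₁
  have u2 := hf.integrableOn_mul (hθ.aestronglyMeasurable_cutoffDefect α) hC₂
  refine ⟨∫ z in Ioi (0 : ℝ), cutoffDefect θ (1 - α) z * f z,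
    -∫ z in Ioi (0 : ℝ), cutoffDefect θ α z * f z, fun x hx => ?_⟩
  have hint := hθ.integrable_prod_dixonKernel_left h0 h1 hf hx
  have hinner : ∀ y : ℝ,
      ∫ z in Ioi (0 : ℝ), dixonKernel α (θ y) x y / ((z : ℂ) + y) * f z =
        dixonKernel α (θ y) x y * ∫ z in Ioi (0 : ℝ), f z / ((y : ℂ) + z) := by
    intro y
    rw [← integral_const_mul]
    congr 1
    funext z
    rw [add_comm (z : ℂ)]
    ring
  have hae : ∀ᵐ z ∂(volume.restrict (Ioi (0 : ℝ))), z ≠ x :=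
    ae_restrict_of_ae (Measure.ae_ne volume x)
  constructor
  · exact hint.integral_prod_left.congr (ae_of_all _ hinner)
  · simp_rw [← hinner]
    rw [integral_integral_swap hint]
    have v1 := (hf.integrableOn_dixonKernel_mul hθ h0 h1 hx).const_mul
      ((Real.pi : ℂ) / Complex.sin (Real.pi * α))
    have v2 := (hf.integrableOn_div_add hx).const_mul
      ((Real.pi : ℂ) * Complex.cot (Real.pi * α))
    have v3 := u1.const_mul ((x : ℂ) ^ (-α))
    have v4 := u2.const_mul ((x : ℂ) ^ (α - 1))
    have v34 : IntegrableOn (fun z : ℝ => (x : ℂ) ^ (-α) * (cutoffDefect θ (1 - α) z * f z) -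
        (x : ℂ) ^ (α - 1) * (cutoffDefect θ α z * f z)) (Ioi 0) := v3.sub v4
    have e : ∀ᵐ z : ℝ ∂(volume.restrict (Ioi (0 : ℝ))),
        ∫ y in Ioi (0 : ℝ), dixonKernel α (θ y) x y / ((z : ℂ) + y) * f z =
          ((Real.pi : ℂ) / Complex.sin (Real.pi * α) * (dixonKernel α (θ z) x z * f z) +
            Real.pi * Complex.cot (Real.pi * α) * (f z / ((x : ℂ) + z))) +
          ((x : ℂ) ^ (-α) * (cutoffDefect θ (1 - α) z * f z) -
            (x : ℂ) ^ (α - 1) * (cutoffDefect θ α z * f z)) := by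
      filter_upwards [ae_restrict_mem measurableSet_Ioi, hae] with z hz hzx
      rw [integral_mul_const, hθ.integral_dixonKernel_left_div_add h0 h1 hx hz hzx]
      ring
    rw [integral_congr_ae e, integral_add (v1.fun_add v2) v34, integral_add v1 v2,
      integral_sub v3 v4]
    simp only [integral_const_mul]
    ring

theorem AdmissiblePair.exists_isCutoff {φ₁ φ₂ : ℝ → ℝ} (h : AdmissiblePair φ₁ φ₂) :
    ∃ D, IsCutoff φ₂ D := by
  obtain ⟨-, hc, hφ, hinf, hzero⟩ := h
  obtain ⟨M, hM⟩ := hinf.bound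
  obtain ⟨Y, hY⟩ := Filter.eventually_atTop.1 hM
  obtain ⟨N, hN⟩ := hzero.bound
  obtain ⟨δ, hδ, hN⟩ := mem_nhdsGT_iff_exists_Ioo_subset.1 hN
  have hδ : 0 < δ := hδ
  set Y' := max Y 1 with hY'
  have hY'1 : 1 ≤ Y' := le_max_right _ _
  set δ' := min δ 1 with hδ'
  have hδ'0 : 0 < δ' := lt_min hδ one_pos
  have hδ'1 : δ' ≤ 1 := min_le_right _ _
  have far : ∀ y, 0 < y → φ₁ y ≤ (2 * |M| + 1 + Y') * (1 / (1 + y)) := by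
    intro y hy
    obtain ⟨h1, -, -⟩ := hφ y hy
    rw [mul_one_div, le_div_iff₀ (by positivity)]
    rcases lt_or_ge y Y' with hlt | hge
    · have hm : 0 ≤ |M| := abs_nonneg M
      nlinarith [h1.1, h1.2]
    · have hb := hY y ((le_max_left _ _).trans hge)
      rw [Real.norm_eq_abs, Real.norm_eq_abs, abs_of_pos h1.1, abs_of_pos (by positivity)] at hb
      have hb2 : φ₁ y * y ≤ |M| := by
        have : φ₁ y ≤ |M| * (1 / y) :=
          hb.trans (mul_le_mul_of_nonneg_right (le_abs_self M) (by positivity))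
        rwa [mul_one_div, le_div_iff₀ hy] at this
      nlinarith [h1.1, h1.2]
  have near : ∀ y, 0 < y → φ₂ y ≤ (2 * |N| + 1 + 1 / δ') * (y / (1 + y)) := by
    intro y hy
    obtain ⟨h1, h2, h3⟩ := hφ y hy
    rw [← mul_div_assoc, le_div_iff₀ (by positivity)]
    have hm : 0 ≤ |N| := abs_nonneg N
    rcases lt_or_ge y δ' with hlt | hge
    · have hb : ‖φ₁ y - 1‖ ≤ N * ‖y‖ := hN ⟨hy, hlt.trans_le (min_le_left _ _)⟩
      rw [Real.norm_eq_abs, Real.norm_eq_abs, abs_of_pos hy, abs_sub_comm,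
        abs_of_pos (by linarith [h1.2])] at hb
      have hb2 : φ₂ y ≤ |N| * y := by
        have := mul_le_mul_of_nonneg_right (le_abs_self N) hy.le
        linarith
      have h4 : 0 ≤ 1 / δ' * y := by positivity
      have h5 : φ₂ y * y ≤ φ₂ y * 1 := mul_le_mul_of_nonneg_left (by linarith) h2.1.le
      nlinarith
    · have h4 : 1 ≤ 1 / δ' * y := by
        rw [one_div_mul_eq_div, le_div_iff₀ hδ'0]
        linarith
      have h5 : 0 ≤ |N| * y := by positivity
      nlinarith [h2.1, h2.2]
  refine ⟨(2 * |M| + 1 + Y') + (2 * |N| + 1 + 1 / δ'), hc.aestronglyMeasurable measurableSet_Ioi,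
    fun y hy => (hφ y hy).2.1.1.le, fun y hy => (hφ y hy).2.1.2.le, fun y hy => ?_,
    fun y hy => ?_⟩
  · refine (near y hy).trans (mul_le_mul_of_nonneg_right ?_ (by positivity))
    linarith [abs_nonneg M]
  · have h3 := (hφ y hy).2.2
    rw [show 1 - φ₂ y = φ₁ y by linarith]
    refine (far y hy).trans (mul_le_mul_of_nonneg_right ?_ (by positivity))
    have : 0 < 1 / δ' := by positivity
    linarith [abs_nonneg N]

theorem mul_weighted_kernel_eq_dixonKernel (α : ℂ) {p q : ℝ} (hpq : p + q = 1) {x y : ℝ}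
    (hx : 0 < x) (hy : 0 < y) :
    (x : ℂ) * (((p * (y / x) + q * (x / y) : ℝ) : ℂ) *
      ((((y / x : ℝ) : ℂ) ^ α - ((y / x : ℝ) : ℂ) ^ (1 - α)) / ((x : ℂ) ^ 2 - (y : ℂ) ^ 2))) =
      dixonKernel α q x y := by
  have hs : 0 < x / y := by positivity
  have hp : ((y / x : ℝ) : ℂ) ^ α - ((y / x : ℝ) : ℂ) ^ (1 - α) = powDiff α (x / y) := by
    rw [← inv_div x y, cpow_inv_pos hs, cpow_inv_pos hs, neg_sub, powDiff]
  rw [hp, dixonKernel]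
  rcases eq_or_ne x y with h | h
  · rw [h, div_self hy.ne', powDiff_one]
    simp
  obtain rfl : p = 1 - q := by linarith
  have hx' : (x : ℂ) ≠ 0 := by exact_mod_cast hx.ne'
  have hy' : (y : ℂ) ≠ 0 := by exact_mod_cast hy.ne'
  have hne : (x : ℂ) ^ 2 - (y : ℂ) ^ 2 ≠ 0 := by
    refine sub_ne_zero.2 ?_
    norm_cast
    exact fun e => h ((pow_left_inj₀ hx.le hy.le two_ne_zero).1 e)
  generalize powDiff α (x / y) = w
  have hd : ((x / y : ℝ) : ℂ) ^ 2 - 1 = ((x : ℂ) ^ 2 - (y : ℂ) ^ 2) / (y : ℂ) ^ 2 := by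
    push_cast
    field_simp
  rw [hd]
  push_cast
  field_simp
  ring

theorem cos_pi_mul_ne_zero {α : ℂ} (h0 : 0 < α.re) (h1 : α.re ≤ 1 / 2) (h2 : α ≠ 1 / 2) :
    Complex.cos (Real.pi * α) ≠ 0 := by
  rw [Complex.cos_ne_zero_iff]
  intro k hk
  have hpi : (Real.pi : ℂ) ≠ 0 := by exact_mod_cast Real.pi_ne_zero
  have e : α = ((((2 * k + 1 : ℤ) : ℝ) / 2 : ℝ) : ℂ) := by
    refine mul_left_cancel₀ hpi (hk.trans ?_)
    push_cast
    ring
  rw [e, Complex.ofReal_re] at h0 h1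
  have a : (0 : ℝ) < (2 * k + 1 : ℤ) := by linarith
  have b : ((2 * k + 1 : ℤ) : ℝ) ≤ (1 : ℤ) := by push_cast at h1 ⊢; linarith
  have a' : 0 < 2 * k + 1 := by exact_mod_cast a
  have b' : 2 * k + 1 ≤ 1 := by exact_mod_cast b
  obtain rfl : k = 0 := by omega
  exact h2 (by rw [e]; norm_num)

theorem IsCutoff.eq_add_stieltjes_iff {θ : ℝ → ℝ} {D : ℝ} (hθ : IsCutoff θ D) {α : ℂ}
    (h0 : 0 < α.re) (h1 : α.re < 1) (hcos : Complex.cos (Real.pi * α) ≠ 0) {f g : ℝ → ℂ}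
    (hf : MemE f) (hg : MemE g) :
    (∀ᵐ x ∂(volume.restrict (Ioi (0 : ℝ))), f x = g x +
      Complex.sin (Real.pi * α) / Real.pi * ∫ y in Ioi (0 : ℝ), f y / ((x : ℂ) + y)) ↔
    ∃ A B : ℂ, ∀ᵐ x ∂(volume.restrict (Ioi (0 : ℝ))), f x = g x -
      Complex.tan (Real.pi * α) / Real.pi *
        (∫ y in Ioi (0 : ℝ), dixonKernel α (θ y) x y * g y) +
      A * (x : ℂ) ^ (-α) + B * (x : ℂ) ^ (α - 1) := by
  have hpi : (Real.pi : ℂ) ≠ 0 := by exact_mod_cast Real.pi_ne_zero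
  have hsin := sin_pi_mul_ne_zero (mem_integerComplement_of_re h0 h1)
  constructor
  · intro hae
    obtain ⟨A, B, hAB⟩ := hθ.exists_integral_dixonKernel_mul_stieltjes h0 h1 hf
    refine ⟨-Complex.tan (Real.pi * α) / Real.pi * (Complex.sin (Real.pi * α) / Real.pi) * A,
      -Complex.tan (Real.pi * α) / Real.pi * (Complex.sin (Real.pi * α) / Real.pi) * B, ?_⟩
    filter_upwards [hae, ae_restrict_mem measurableSet_Ioi] with x hfx hx
    obtain ⟨hi, hI⟩ := hAB x hx
    have hg' : ∫ y in Ioi (0 : ℝ), dixonKernel α (θ y) x y * g y =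
        (∫ y in Ioi (0 : ℝ), dixonKernel α (θ y) x y * f y) -
          Complex.sin (Real.pi * α) / Real.pi * ∫ y in Ioi (0 : ℝ), dixonKernel α (θ y) x y *
            ∫ z in Ioi (0 : ℝ), f z / ((y : ℂ) + z) := by
      rw [← integral_const_mul, ← integral_sub (hf.integrableOn_dixonKernel_mul hθ h0 h1 hx)
        (hi.const_mul _)]
      refine integral_congr_ae ?_
      filter_upwards [hae] with y hfy
      rw [hfy]
      ring
    rw [hg', hI]
    have hS : Complex.sin (Real.pi * α) / Real.pi * (∫ y in Ioi (0 : ℝ), f y / ((x : ℂ) + y)) =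
        f x - g x := by rw [hfx]; ring
    generalize (∫ y in Ioi (0 : ℝ), f y / ((x : ℂ) + y)) = S at hS ⊢
    obtain rfl : S = (f x - g x) * Real.pi / Complex.sin (Real.pi * α) := by
      rw [← hS]; field_simp
    rw [Complex.tan_eq_sin_div_cos, Complex.cot_eq_cos_div_sin]
    field_simp
    ring
  · rintro ⟨A, B, hAB⟩
    have h0' : 0 < (1 - α).re := by simpa using h1
    have h1' : (1 - α).re < 1 := by simpa using h0
    filter_upwards [hAB, ae_restrict_mem measurableSet_Ioi] with x hfx hx
    obtain ⟨hi, hI⟩ := hθ.integral_dixon_div_add h0 h1 hg hx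
    set c := Complex.tan (Real.pi * α) / Real.pi with hc
    have i1 := hg.integrableOn_div_add hx
    have i2 := hi.const_mul c
    have i3 := (integrableOn_cpow_div_add h0 h1 hx).const_mul A
    have i4 := (integrableOn_cpow_div_add h0' h1' hx).const_mul B
    have i12 : IntegrableOn (fun z : ℝ => g z / ((x : ℂ) + z) -
        c * ((∫ y in Ioi (0 : ℝ), dixonKernel α (θ y) z y * g y) / ((x : ℂ) + z))) (Ioi 0) :=
      i1.sub i2
    have e : ∀ᵐ z : ℝ ∂(volume.restrict (Ioi (0 : ℝ))), f z / ((x : ℂ) + z) =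
        (g z / ((x : ℂ) + z) -
        c * ((∫ y in Ioi (0 : ℝ), dixonKernel α (θ y) z y * g y) / ((x : ℂ) + z))) +
        (A * ((z : ℂ) ^ (-α) / ((x : ℂ) + z)) + B * ((z : ℂ) ^ (-(1 - α)) / ((x : ℂ) + z))) := by
      filter_upwards [hAB] with z hfz
      rw [hfz, neg_sub]
      ring
    rw [integral_congr_ae e, integral_add i12 (i3.fun_add i4), integral_sub i1 i2,
      integral_add i3 i4]
    simp only [integral_const_mul]
    rw [hI, integral_cpow_div_add h0 h1 hx, integral_cpow_div_add h0' h1' hx,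
      sin_pi_mul_one_sub, neg_sub, hfx, hc, Complex.tan_eq_sin_div_cos,
      Complex.cot_eq_cos_div_sin]
    field_simp
    ring

/-- Theorem 1(iii): for `0 < Re α ≤ 1/2`, `α ≠ 1/2`, `λ = sin(πα)/π`,
`g ∈ E` and an admissible weight pair `(φ₁, φ₂)`, a function `f ∈ E` satisfies the
Stieltjes equation a.e. iff there are constants `A, B` with
`f(x) = g(x) - (tan(πα)/π)·x·∫₀^∞ (φ₁(y)(y/x) + φ₂(y)(x/y))·((y/x)^α - (y/x)^{1-α})/(x²-y²)·g(y) dy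
  + A·x^{-α} + B·x^{α-1}` a.e. -/
theorem stmt11 (α : ℂ) (hα1 : 0 < α.re) (hα2 : α.re ≤ 1/2) (hα3 : α ≠ 1/2)
    (lam : ℂ) (hlam : lam = Complex.sin ((Real.pi : ℂ) * α) / (Real.pi : ℂ))
    (g : ℝ → ℂ) (hg : MemE g)
    (φ₁ φ₂ : ℝ → ℝ) (hφ : AdmissiblePair φ₁ φ₂) (f : ℝ → ℂ) (hf : MemE f) :
    ((∀ x : ℝ, 0 < x → IntegrableOn (fun y : ℝ => f y / ((x : ℂ) + (y : ℂ))) (Ioi 0)) ∧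
      (∀ᵐ x ∂(volume.restrict (Ioi (0 : ℝ))),
        f x = g x + lam * ∫ y in Ioi (0 : ℝ), f y / ((x : ℂ) + (y : ℂ))))
    ↔
    ((∀ x : ℝ, 0 < x → IntegrableOn (fun y : ℝ =>
        ((φ₁ y * (y / x) + φ₂ y * (x / y) : ℝ) : ℂ) *
          ((((y / x : ℝ) : ℂ) ^ α - ((y / x : ℝ) : ℂ) ^ (1 - α)) /
            ((x : ℂ) ^ 2 - (y : ℂ) ^ 2)) * g y) (Ioi 0)) ∧
      ∃ A B : ℂ, (∀ᵐ x ∂(volume.restrict (Ioi (0 : ℝ))),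
        f x = g x - Complex.tan ((Real.pi : ℂ) * α) / (Real.pi : ℂ) * (x : ℂ) *
            (∫ y in Ioi (0 : ℝ),
              ((φ₁ y * (y / x) + φ₂ y * (x / y) : ℝ) : ℂ) *
                ((((y / x : ℝ) : ℂ) ^ α - ((y / x : ℝ) : ℂ) ^ (1 - α)) /
                  ((x : ℂ) ^ 2 - (y : ℂ) ^ 2)) * g y) +
          A * (x : ℂ) ^ (-α) + B * (x : ℂ) ^ (α - 1))) := by
  subst hlam
  have h1 : α.re < 1 := by linarith
  obtain ⟨D, hθ⟩ := hφ.exists_isCutoff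
  have hk : ∀ x : ℝ, 0 < x → ∀ y ∈ Ioi (0 : ℝ),
      ((φ₁ y * (y / x) + φ₂ y * (x / y) : ℝ) : ℂ) *
        ((((y / x : ℝ) : ℂ) ^ α - ((y / x : ℝ) : ℂ) ^ (1 - α)) /
          ((x : ℂ) ^ 2 - (y : ℂ) ^ 2)) * g y =
      (x : ℂ)⁻¹ * (dixonKernel α (φ₂ y) x y * g y) := by
    intro x hx y hy
    have hx' : (x : ℂ) ≠ 0 := by exact_mod_cast hx.ne'
    rw [← mul_weighted_kernel_eq_dixonKernel α (hφ.2.2.1 y hy).2.2 hx hy, mul_assoc (x : ℂ),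
      inv_mul_cancel_left₀ hx']
  have hint : ∀ x : ℝ, 0 < x → IntegrableOn (fun y : ℝ =>
      ((φ₁ y * (y / x) + φ₂ y * (x / y) : ℝ) : ℂ) *
        ((((y / x : ℝ) : ℂ) ^ α - ((y / x : ℝ) : ℂ) ^ (1 - α)) /
          ((x : ℂ) ^ 2 - (y : ℂ) ^ 2)) * g y) (Ioi 0) := fun x hx =>
    (integrableOn_congr_fun (hk x hx) measurableSet_Ioi).2
      ((hg.integrableOn_dixonKernel_mul hθ hα1 h1 hx).const_mul _)
  rw [and_iff_right hint, and_iff_right fun x hx => hf.integrableOn_div_add hx,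
    hθ.eq_add_stieltjes_iff hα1 h1 (cos_pi_mul_ne_zero hα1 hα2 hα3) hf hg]
  refine exists_congr fun A => exists_congr fun B => Filter.eventually_congr ?_
  filter_upwards [ae_restrict_mem measurableSet_Ioi] with x hx
  have hx' : (x : ℂ) ≠ 0 := by exact_mod_cast (ne_of_gt hx : x ≠ 0)
  rw [setIntegral_congr_fun measurableSet_Ioi (hk x hx), integral_const_mul,
    mul_assoc _ (x : ℂ), mul_inv_cancel_left₀ hx']

end
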